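/- Let R be a standard bigraded K-algebra with irrelevant bigraded ideals P and Q, where P is minimally generated by m homogeneous elements, and let M be a finitely generated bigraded R-module with dim M = s and depth M = s - 1. Then there is a long exact sequence of bigraded R-modules ⋯ → H^{m-j-2}_P(H^{s-1}_{R_+}(M)^∨) → H^{m-j}_P(H^s_{R_+}(M)^∨) → H^{s-m+j}_Q(M)^∨ → H^{m-j-1}_P(H^{s-1}_{R_+}(M)^∨) → H^{m-j+1}_P(H^s_{R_+}(M)^∨) → ⋯ . -/

import Mathlib

/-!
Common framework: standard bigraded algebras, bigraded modules, bigraded Matlis duals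
(characterized by a perfect pairing), and `ℤ`-indexed local cohomology.
-/

open CategoryTheory

universe u

noncomputable section

/-- `ℤ`-indexed local cohomology: `H^k_I(M)` for `k : ℤ`, zero for negative `k`. -/
noncomputable def LC (R : Type u) [CommRing R] (I : Ideal R) (k : ℤ)
    (M : Type u) [AddCommGroup M] [Module R M] : ModuleCat.{u} R :=
  if 0 ≤ k then (localCohomology I k.toNat).obj (ModuleCat.of R M)
  else ModuleCat.of R PUnit

variable (K R : Type u) [Field K] [CommRing R] [Algebra K R] (𝒜 : ℕ × ℕ → Submodule K R)

/-- The irrelevant bigraded ideal `P` generated by all elements of degree `(1,0)`. -/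
def idealP : Ideal R := Ideal.span (𝒜 (1, 0) : Set R)

/-- The irrelevant bigraded ideal `Q` generated by all elements of degree `(0,1)`. -/
def idealQ : Ideal R := Ideal.span (𝒜 (0, 1) : Set R)

/-- The unique graded maximal ideal `R₊ = P + Q`. -/
def idealRPlus : Ideal R := idealP K R 𝒜 ⊔ idealQ K R 𝒜

/-- `R` is a standard bigraded `K`-algebra: `R_{(0,0)} = K` and `R` is generated over `K`
by the (finite-dimensional) components of degrees `(1,0)` and `(0,1)`. -/
structure IsStandardBigraded [GradedAlgebra 𝒜] : Prop where
  degree_zero : 𝒜 (0, 0) = Subalgebra.toSubmodule (⊥ : Subalgebra K R)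
  fg10 : (𝒜 (1, 0)).FG
  fg01 : (𝒜 (0, 1)).FG
  adjoin_eq_top : Algebra.adjoin K ((𝒜 (1, 0) : Set R) ∪ (𝒜 (0, 1) : Set R)) = ⊤

/-- A bigraded `R`-module structure on `M`: an internal direct sum decomposition into
`K`-stable additive subgroups, compatible with the bigrading `𝒜` of `R`. -/
structure Bigrading (M : Type u) [AddCommGroup M] [Module R M] : Type u where
  grading : ℤ × ℤ → AddSubgroup M
  ksmul_mem : ∀ (c : K) (b : ℤ × ℤ) (x : M), x ∈ grading b → algebraMap K R c • x ∈ grading b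
  internal : DirectSum.IsInternal grading
  compat : ∀ (a : ℕ × ℕ) (b : ℤ × ℤ) (r : R) (x : M), r ∈ 𝒜 a → x ∈ grading b →
    r • x ∈ grading (((a.1 : ℤ), (a.2 : ℤ)) + b)

/-- Data exhibiting a bigraded Matlis dual of `M`: a bigrading `src` on `M`, a bigraded
`R`-module `D`, and an `R`-balanced `K`-bilinear pairing `D × M → K` which puts the component
of `D` of degree `a` in perfect duality with the component of `M` of degree `-a`
(and is zero between components of degrees `a`, `b` with `a + b ≠ 0`).  This characterizes
`D` as the bigraded module with `D_{(i,j)} = Hom_K (M_{(-i,-j)}, K)`. -/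
structure DualData (M : Type u) [AddCommGroup M] [Module R M] : Type (u + 1) where
  src : Bigrading K R 𝒜 M
  D : Type u
  [addCommGroup : AddCommGroup D]
  [module : Module R D]
  bg : Bigrading K R 𝒜 D
  pairing : D →+ M →+ K
  pairing_smul : ∀ (r : R) (d : D) (x : M), pairing (r • d) x = pairing d (r • x)
  pairing_ksmul : ∀ (c : K) (d : D) (x : M), pairing (algebraMap K R c • d) x = c * pairing d x
  orth : ∀ (a b : ℤ × ℤ), a + b ≠ 0 → ∀ d ∈ bg.grading a, ∀ x ∈ src.grading b, pairing d x = 0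
  nondeg : ∀ (a : ℤ × ℤ) (d : D), d ∈ bg.grading a →
    (∀ x ∈ src.grading (-a), pairing d x = 0) → d = 0
  full : ∀ (a : ℤ × ℤ) (φ : M →+ K),
    (∀ (c : K) (x : M), φ (algebraMap K R c • x) = c * φ x) →
    ∃ d ∈ bg.grading a, ∀ x ∈ src.grading (-a), pairing d x = φ x

attribute [instance] DualData.addCommGroup DualData.module

/-- A bigraded module is tame if, viewing it as graded by the second degree `j`
(with components `N_j = ⊕_i N_{(i,j)}`), there is `j₀` such that either all components with
`j ≤ j₀` vanish, or all components with `j ≤ j₀` are nonzero. -/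
def IsTame {M : Type u} [AddCommGroup M] [Module R M] (bg : Bigrading K R 𝒜 M) : Prop :=
  ∃ j₀ : ℤ, (∀ j ≤ j₀, ∀ i : ℤ, bg.grading (i, j) = ⊥) ∨ (∀ j ≤ j₀, ∃ i : ℤ, bg.grading (i, j) ≠ ⊥)

/-- The ideal `P` is minimally generated by `m` (homogeneous, of degree `(1,0)`) elements. -/
def MinimallyGeneratedBy (m : ℕ) : Prop :=
  (∃ s : Finset R, (↑s : Set R) ⊆ (𝒜 (1, 0) : Set R) ∧ Ideal.span (↑s : Set R) = idealP K R 𝒜 ∧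
      s.card = m) ∧
  ∀ s : Finset R, Ideal.span (↑s : Set R) = idealP K R 𝒜 → m ≤ s.card

section LeftDerived

variable {C D : Type*} [Category* C] [Category* D] [Abelian C] [HasProjectiveResolutions C]
  [Abelian D] {F₁ F₂ F₃ : C ⥤ D} [F₁.Additive] [F₂.Additive] [F₃.Additive]

/-- The short complex of chain complexes obtained by applying a complex of functors to a chain
complex. -/
def mapChainShortComplex (α : F₁ ⟶ F₂) (β : F₂ ⟶ F₃) (w : ∀ X, α.app X ≫ β.app X = 0)
    (P : ChainComplex C ℕ) : ShortComplex (ChainComplex D ℕ) :=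
  ShortComplex.mk ((NatTrans.mapHomologicalComplex α (ComplexShape.down ℕ)).app P)
    ((NatTrans.mapHomologicalComplex β (ComplexShape.down ℕ)).app P) (by ext i; exact w _)

/-- Functoriality of `mapChainShortComplex` in the chain complex. -/
def mapChainShortComplexMap (α : F₁ ⟶ F₂) (β : F₂ ⟶ F₃) (w : ∀ X, α.app X ≫ β.app X = 0)
    {P Q : ChainComplex C ℕ} (f : P ⟶ Q) :
    mapChainShortComplex α β w P ⟶ mapChainShortComplex α β w Q where
  τ₁ := (F₁.mapHomologicalComplex _).map f
  τ₂ := (F₂.mapHomologicalComplex _).map f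
  τ₃ := (F₃.mapHomologicalComplex _).map f
  comm₁₂ := (NatTrans.mapHomologicalComplex α (ComplexShape.down ℕ)).naturality f
  comm₂₃ := (NatTrans.mapHomologicalComplex β (ComplexShape.down ℕ)).naturality f

omit [HasProjectiveResolutions C] in
lemma mapChainShortComplex_shortExact (α : F₁ ⟶ F₂) (β : F₂ ⟶ F₃)
    (w : ∀ X, α.app X ≫ β.app X = 0)
    (h : ∀ (P : C) [Projective P], (ShortComplex.mk (α.app P) (β.app P) (w P)).ShortExact)
    {X : C} (P : ProjectiveResolution X) :
    (mapChainShortComplex α β w P.complex).ShortExact := by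
  apply HomologicalComplex.shortExact_of_degreewise_shortExact
  intro i
  exact h (P.complex.X i)

theorem exists_leftDerived_connecting (α : F₁ ⟶ F₂) (β : F₂ ⟶ F₃)
    (w : ∀ X, α.app X ≫ β.app X = 0)
    (h : ∀ (P : C) [Projective P], (ShortComplex.mk (α.app P) (β.app P) (w P)).ShortExact)
    (n : ℕ) :
    ∃ δ : F₃.leftDerived (n + 1) ⟶ F₁.leftDerived n,
      ∀ X, (∃ z, (ShortComplex.mk (δ.app X) ((NatTrans.leftDerived α n).app X) z).Exact) ∧
        (∃ z, (ShortComplex.mk ((NatTrans.leftDerived β (n + 1)).app X) (δ.app X) z).Exact) := by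
  let P (X : C) := projectiveResolution X
  let hS (X : C) := mapChainShortComplex_shortExact α β w h (P X)
  let d (X : C) : (mapChainShortComplex α β w (P X).complex).X₃.homology (n + 1) ⟶
      (mapChainShortComplex α β w (P X).complex).X₁.homology n := (hS X).δ (n + 1) n rfl
  let e₁ (X : C) (k : ℕ) :
      (F₁.leftDerived k).obj X ≅ (mapChainShortComplex α β w (P X).complex).X₁.homology k := (P X).isoLeftDerivedObj F₁ k
  let e₂ (X : C) (k : ℕ) :
      (F₂.leftDerived k).obj X ≅ (mapChainShortComplex α β w (P X).complex).X₂.homology k := (P X).isoLeftDerivedObj F₂ k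
  let e₃ (X : C) (k : ℕ) :
      (F₃.leftDerived k).obj X ≅ (mapChainShortComplex α β w (P X).complex).X₃.homology k := (P X).isoLeftDerivedObj F₃ k
  refine ⟨{ app := fun X => (e₃ X (n + 1)).hom ≫ d X ≫ (e₁ X n).inv
            naturality := ?_ }, fun X => ⟨?_, ?_⟩⟩
  · intro X Y f
    let φ := ProjectiveResolution.lift f (P X) (P Y)
    have hφ : φ.f 0 ≫ (P Y).π.f 0 = (P X).π.f 0 ≫ f := ProjectiveResolution.lift_commutes_zero f _ _
    have h3 := ProjectiveResolution.isoLeftDerivedObj_hom_naturality f (P X) (P Y) φ hφ F₃ (n + 1)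
    have h1 := ProjectiveResolution.isoLeftDerivedObj_inv_naturality f (P X) (P Y) φ hφ F₁ n
    have hd := HomologicalComplex.HomologySequence.δ_naturality
      (mapChainShortComplexMap α β w φ) (hS X) (hS Y) (n + 1) n rfl
    change _ ≫ (e₃ Y (n + 1)).hom ≫ d Y ≫ (e₁ Y n).inv
      = ((e₃ X (n + 1)).hom ≫ d X ≫ (e₁ X n).inv) ≫ _
    have h3' : (F₃.leftDerived (n+1)).map f ≫ (e₃ Y (n+1)).hom = (e₃ X (n+1)).hom ≫
      HomologicalComplex.homologyMap (mapChainShortComplexMap α β w φ).τ₃ (n+1) := h3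
    have h1' : (e₁ X n).inv ≫ (F₁.leftDerived n).map f =
      HomologicalComplex.homologyMap (mapChainShortComplexMap α β w φ).τ₁ n ≫ (e₁ Y n).inv := h1
    have hd' : d X ≫ HomologicalComplex.homologyMap (mapChainShortComplexMap α β w φ).τ₁ n =
      HomologicalComplex.homologyMap (mapChainShortComplexMap α β w φ).τ₃ (n + 1) ≫ d Y := hd
    rw [← Category.assoc, h3', Category.assoc, Category.assoc, Category.assoc, h1',
      ← Category.assoc (d X), hd', Category.assoc]
  · have h2 : (NatTrans.leftDerived α n).app X = (e₁ X n).hom ≫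
        HomologicalComplex.homologyMap (mapChainShortComplex α β w (P X).complex).f n ≫
        (e₂ X n).inv := ProjectiveResolution.leftDerived_app_eq α (P X) n
    have hex := (hS X).homology_exact₁ (n + 1) n rfl
    have z : ((e₃ X (n + 1)).hom ≫ d X ≫ (e₁ X n).inv) ≫ (NatTrans.leftDerived α n).app X = 0 := by
      rw [h2]
      simp only [Category.assoc, Iso.inv_hom_id_assoc]
      have hz : d X ≫ HomologicalComplex.homologyMap
          (mapChainShortComplex α β w (P X).complex).f n = 0 := (hS X).δ_comp (n + 1) n rfl
      rw [← Category.assoc (d X), hz]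
      simp
    refine ⟨z, ?_⟩
    refine (ShortComplex.exact_iff_of_iso (ShortComplex.isoMk (e₃ X (n + 1)) (e₁ X n) (e₂ X n)
      ?_ ?_)).2 hex
    · simp [d]
    · simp [h2]
  · have h2 : (NatTrans.leftDerived β (n + 1)).app X = (e₂ X (n + 1)).hom ≫
        HomologicalComplex.homologyMap (mapChainShortComplex α β w (P X).complex).g (n + 1) ≫
        (e₃ X (n + 1)).inv := ProjectiveResolution.leftDerived_app_eq β (P X) (n + 1)
    have hex := (hS X).homology_exact₃ (n + 1) n rfl
    have z : (NatTrans.leftDerived β (n + 1)).app X ≫ ((e₃ X (n + 1)).hom ≫ d X ≫ (e₁ X n).inv)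
        = 0 := by
      rw [h2]
      simp only [Category.assoc, Iso.inv_hom_id_assoc]
      have hz : HomologicalComplex.homologyMap
          (mapChainShortComplex α β w (P X).complex).g (n + 1) ≫ d X = 0 :=
        (hS X).comp_δ (n + 1) n rfl
      rw [← Category.assoc (HomologicalComplex.homologyMap _ _), hz]
      simp
    refine ⟨z, ?_⟩
    refine (ShortComplex.exact_iff_of_iso (ShortComplex.isoMk (e₂ X (n + 1)) (e₃ X (n + 1))
      (e₁ X n) ?_ ?_)).2 hex
    · simp [h2]
    · simp [d]

end LeftDerived

section ExtModule

variable {R}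

/-- The functor `Ext R (ModuleCat R) n` with its second argument fixed. -/
abbrev extFlip (n : ℕ) (N : ModuleCat.{u} R) : (ModuleCat.{u} R)ᵒᵖ ⥤ ModuleCat.{u} R :=
  (Ext R (ModuleCat.{u} R) n).flip.obj N

lemma isZero_ext_succ_of_injective (n : ℕ) (Y : (ModuleCat.{u} R)ᵒᵖ) (J : ModuleCat.{u} R)
    [Injective J] : Limits.IsZero ((extFlip (n + 1) J).obj Y) := by
  let P := projectiveResolution Y.unop
  refine Limits.IsZero.of_iso ?_ (P.isoExt (R := R) (n + 1) J)
  rw [← HomologicalComplex.exactAt_iff_isZero_homology,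
    HomologicalComplex.exactAt_iff' _ n (n + 1) (n + 2) (by simp) (by simp),
    ShortComplex.moduleCat_exact_iff]
  intro (f : P.complex.X (n + 1) ⟶ J) (hf : P.complex.d (n + 2) (n + 1) ≫ f = 0)
  have hP := (HomologicalComplex.exactAt_iff' P.complex (n + 2) (n + 1) n (by simp) (by simp)).1
    (P.complex_exactAt_succ n)
  exact ⟨hP.descToInjective f hf, hP.comp_descToInjective f hf⟩

variable {S : ShortComplex (ModuleCat.{u} R)}

lemma linearYoneda_shortExact_op (hS : S.ShortExact) (P : ModuleCat.{u} R) [Projective P]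
    (w : (NatTrans.rightOp ((linearYoneda R (ModuleCat.{u} R)).map S.g)).app P ≫
      (NatTrans.rightOp ((linearYoneda R (ModuleCat.{u} R)).map S.f)).app P = 0) :
    (ShortComplex.mk _ _ w).ShortExact := by
  have := hS.mono_f
  have := hS.epi_g
  let T : ShortComplex (ModuleCat.{u} R) :=
    ShortComplex.mk (((linearYoneda R (ModuleCat.{u} R)).map S.f).app (Opposite.op P))
      (((linearYoneda R (ModuleCat.{u} R)).map S.g).app (Opposite.op P))
      (by ext (f : P ⟶ S.X₁); change (f ≫ S.f) ≫ S.g = 0; simp)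
  have hT : T.ShortExact := by
    refine ShortComplex.ShortExact.mk' ?_ ?_ ?_
    · rw [ShortComplex.moduleCat_exact_iff]
      intro (f : P ⟶ S.X₂) (hf : f ≫ S.g = 0)
      exact ⟨hS.exact.lift f hf, hS.exact.lift_f f hf⟩
    · rw [ModuleCat.mono_iff_injective]
      intro (f : P ⟶ S.X₁) (g : P ⟶ S.X₁) (h : f ≫ S.f = g ≫ S.f)
      exact (cancel_mono S.f).1 h
    · rw [ModuleCat.epi_iff_surjective]
      intro (f : P ⟶ S.X₃)
      exact ⟨Projective.factorThru f S.g, Projective.factorThru_comp f S.g⟩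
  exact hT.op

theorem exists_ext_connecting (hS : S.ShortExact) [Injective S.X₂] (n : ℕ) :
    ∃ δ : extFlip n S.X₃ ⟶ extFlip (n + 1) S.X₁, ∀ Y,
      (∃ z, (ShortComplex.mk (((Ext R (ModuleCat.{u} R) n).flip.map S.g).app Y)
        (δ.app Y) z).Exact) ∧ Epi (δ.app Y) := by
  obtain ⟨δ, hδ⟩ := exists_leftDerived_connecting
    (NatTrans.rightOp ((linearYoneda R (ModuleCat.{u} R)).map S.g))
    (NatTrans.rightOp ((linearYoneda R (ModuleCat.{u} R)).map S.f))
    (by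
      intro X
      apply Quiver.Hom.unop_inj
      ext (f : X ⟶ S.X₁)
      change (f ≫ S.f) ≫ S.g = 0
      simp)
    (fun P _ => linearYoneda_shortExact_op hS P _) n
  refine ⟨NatTrans.leftOp δ, fun Y => ⟨?_, ?_⟩⟩
  · obtain ⟨⟨z, hz⟩, -⟩ := hδ Y.unop
    exact ⟨congrArg Quiver.Hom.unop z, hz.unop⟩
  · obtain ⟨-, z, hz⟩ := hδ Y.unop
    have h0 := isZero_ext_succ_of_injective n Y S.X₂
    exact hz.unop.epi_f (h0.eq_of_tgt _ _)

end ExtModule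

section TorsionCohomology

variable {R}

/-- A sequence of functors which is effaceable by injective modules and whose degree zero term
is the submodule of elements annihilated by a power of `I`. -/
structure IsTorsionCohomology (I : Ideal R) (T : ℕ → ModuleCat.{u} R ⥤ ModuleCat.{u} R) : Prop where
  zero : ∃ ε : T 0 ⟶ 𝟭 _, ∀ N, Function.Injective (ε.app N) ∧
    ∀ x : N, (∃ y, ε.app N y = x) ↔ ∃ t : ℕ, ∀ r ∈ I ^ t, r • x = 0
  connecting : ∀ S : ShortComplex (ModuleCat.{u} R), S.ShortExact → Injective S.X₂ → ∀ n,
    ∃ δ : (T n).obj S.X₃ ⟶ (T (n + 1)).obj S.X₁,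
      Function.Exact ((T n).map S.g) δ ∧ Function.Surjective δ
  vanishing : ∀ n J, Injective J → Limits.IsZero ((T (n + 1)).obj J)

/-- Two right exact sequences with compatible isomorphic first terms have isomorphic cokernels. -/
lemma nonempty_equiv_of_exact {A B C A' B' C' : Type*} [AddCommGroup A] [AddCommGroup B]
    [AddCommGroup C] [AddCommGroup A'] [AddCommGroup B'] [AddCommGroup C'] [Module R A] [Module R B]
    [Module R C] [Module R A'] [Module R B'] [Module R C']
    {f : A →ₗ[R] B} {g : B →ₗ[R] C} {f' : A' →ₗ[R] B'} {g' : B' →ₗ[R] C'}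
    (h : Function.Exact f g) (hg : Function.Surjective g)
    (h' : Function.Exact f' g') (hg' : Function.Surjective g')
    (a : A ≃ₗ[R] A') (b : B ≃ₗ[R] B') (hab : ∀ x, b (f x) = f' (a x)) :
    Nonempty (C ≃ₗ[R] C') := by
  have hr : Submodule.map b.toLinearMap (LinearMap.ker g) = LinearMap.ker g' := by
    rw [h.linearMap_ker_eq, h'.linearMap_ker_eq]
    ext y
    simp only [Submodule.mem_map, LinearMap.mem_range]
    constructor
    · rintro ⟨_, ⟨x, rfl⟩, rfl⟩
      exact ⟨a x, (hab x).symm⟩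
    · rintro ⟨x, rfl⟩
      exact ⟨f (a.symm x), ⟨_, rfl⟩, by simp [hab]⟩
  exact ⟨(g.quotKerEquivOfSurjective hg).symm ≪≫ₗ
    (Submodule.Quotient.equiv _ _ b hr) ≪≫ₗ g'.quotKerEquivOfSurjective hg'⟩

theorem IsTorsionCohomology.nonempty_linearEquiv {I : Ideal R}
    {T T' : ℕ → ModuleCat.{u} R ⥤ ModuleCat.{u} R}
    (hT : IsTorsionCohomology I T) (hT' : IsTorsionCohomology I T') (n : ℕ) (N : ModuleCat.{u} R) :
    Nonempty ((T n).obj N ≃ₗ[R] (T' n).obj N) := by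
  obtain ⟨ε, hε⟩ := hT.zero
  obtain ⟨ε', hε'⟩ := hT'.zero
  have hrange (N : ModuleCat.{u} R) :
      LinearMap.range (ε.app N).hom = LinearMap.range (ε'.app N).hom := by
    ext x
    exact ((hε N).2 x).trans ((hε' N).2 x).symm
  let e (N : ModuleCat.{u} R) : (T 0).obj N ≃ₗ[R] (T' 0).obj N :=
    (LinearEquiv.ofInjective (ε.app N).hom (hε N).1) ≪≫ₗ (LinearEquiv.ofEq _ _ (hrange N)) ≪≫ₗ
      (LinearEquiv.ofInjective (ε'.app N).hom (hε' N).1).symm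
  have he (N : ModuleCat.{u} R) (x : (T 0).obj N) : ε'.app N (e N x) = ε.app N x := by
    have := LinearEquiv.apply_symm_apply (LinearEquiv.ofInjective (ε'.app N).hom (hε' N).1)
      (LinearEquiv.ofEq _ _ (hrange N) (LinearEquiv.ofInjective (ε.app N).hom (hε N).1 x))
    exact congrArg Subtype.val this
  have henat {N N' : ModuleCat.{u} R} (f : N ⟶ N') (x : (T 0).obj N) :
      e N' ((T 0).map f x) = (T' 0).map f (e N x) := by
    apply (hε' N').1
    rw [he, NatTrans.naturality_apply ε', he, NatTrans.naturality_apply ε]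
  induction n generalizing N with
  | zero => exact ⟨e N⟩
  | succ n ih =>
    let p := (EnoughInjectives.presentation N).some
    obtain ⟨δ, h, hs⟩ := hT.connecting _ p.shortExact_shortComplex p.injective n
    obtain ⟨δ', h', hs'⟩ := hT'.connecting _ p.shortExact_shortComplex p.injective n
    cases n with
    | zero =>
      exact nonempty_equiv_of_exact (f := ((T 0).map p.shortComplex.g).hom)
        (f' := ((T' 0).map p.shortComplex.g).hom) (g := δ.hom) (g' := δ'.hom) h hs h' hs'
        (e p.shortComplex.X₂) (e p.shortComplex.X₃) (fun x => henat p.shortComplex.g x)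
    | succ k =>
      obtain ⟨b⟩ := ih p.shortComplex.X₃
      have := ModuleCat.subsingleton_of_isZero (hT.vanishing k p.J p.injective)
      have := ModuleCat.subsingleton_of_isZero (hT'.vanishing k p.J p.injective)
      let a : (T (k + 1)).obj p.J ≃ₗ[R] (T' (k + 1)).obj p.J := 0
      refine nonempty_equiv_of_exact (f := ((T (k + 1)).map p.shortComplex.g).hom)
        (f' := ((T' (k + 1)).map p.shortComplex.g).hom) (g := δ.hom) (g' := δ'.hom) h hs h' hs' a b
        (fun x => ?_)
      rw [Subsingleton.elim x 0, map_zero, map_zero, map_zero, map_zero]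

end TorsionCohomology

section LocalCohomologyColimit

variable {R}

open Limits

/-- The directed system computing the `n`-th local cohomology of `N`. -/
abbrev extSystem (I : Ideal R) (n : ℕ) (N : ModuleCat.{u} R) : (ℕᵒᵖ)ᵒᵖ ⥤ ModuleCat.{u} R :=
  localCohomology.diagram (localCohomology.idealPowersDiagram I) n ⋙
    (evaluation (ModuleCat.{u} R) (ModuleCat.{u} R)).obj N

/-- Local cohomology as a colimit of modules. -/
def localCohomologyObjIso (I : Ideal R) (n : ℕ) (N : ModuleCat.{u} R) :
    (localCohomology I n).obj N ≅ colimit (extSystem I n N) :=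
  colimitObjIsoColimitCompEvaluation _ N

lemma localCohomologyObjIso_naturality (I : Ideal R) (n : ℕ) {N N' : ModuleCat.{u} R} (f : N ⟶ N') :
    (localCohomology I n).map f ≫ (localCohomologyObjIso I n N').hom =
      (localCohomologyObjIso I n N).hom ≫
        colim.map (Functor.whiskerLeft
          (localCohomology.diagram (localCohomology.idealPowersDiagram I) n)
          ((evaluation (ModuleCat.{u} R) (ModuleCat.{u} R)).map f)) :=
  colimit_map_colimitObjIsoColimitCompEvaluation_hom _ f

lemma exact_of_exact_evaluation {J : Type*} [Category J] (T : ShortComplex (J ⥤ ModuleCat.{u} R))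
    (h : ∀ j, (T.map ((evaluation J (ModuleCat.{u} R)).obj j)).Exact) : T.Exact := by
  rw [ShortComplex.exact_iff_isZero_homology, Functor.isZero_iff]
  intro j
  exact ((ShortComplex.exact_iff_isZero_homology _).1 (h j)).of_iso
    (T.mapHomologyIso ((evaluation J (ModuleCat.{u} R)).obj j)).symm

lemma localCohomology_connecting (I : Ideal R) {S : ShortComplex (ModuleCat.{u} R)}
    (hS : S.ShortExact) [Injective S.X₂] (n : ℕ) :
    ∃ δ : (localCohomology I n).obj S.X₃ ⟶ (localCohomology I (n + 1)).obj S.X₁,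
      Function.Exact ((localCohomology I n).map S.g) δ ∧ Function.Surjective δ := by
  obtain ⟨δ, hδ⟩ := exists_ext_connecting hS n
  let W := localCohomology.ringModIdeals (localCohomology.idealPowersDiagram I)
  let a : extSystem I n S.X₂ ⟶ extSystem I n S.X₃ := Functor.whiskerLeft
    (localCohomology.diagram (localCohomology.idealPowersDiagram I) n)
    ((evaluation (ModuleCat.{u} R) (ModuleCat.{u} R)).map S.g)
  let b : extSystem I n S.X₃ ⟶ extSystem I (n + 1) S.X₁ := Functor.whiskerLeft W.op δ
  have hz : a ≫ b = 0 := by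
    ext t : 2
    exact (hδ (W.op.obj t)).1.choose
  let T := ShortComplex.mk a b hz
  have hT : T.Exact := exact_of_exact_evaluation T fun t => (hδ (W.op.obj t)).1.choose_spec
  have hb : Epi T.g := by
    have : ∀ t, Epi (b.app t) := fun t => (hδ (W.op.obj t)).2
    exact NatTrans.epi_of_epi_app b
  have hc := hT.map_of_epi_of_preservesCokernel colim hb inferInstance
  refine ⟨(localCohomologyObjIso I n S.X₃).hom ≫ colim.map b ≫
    (localCohomologyObjIso I (n + 1) S.X₁).inv, ?_, ?_⟩
  · rw [ShortComplex.ShortExact.moduleCat_exact_iff_function_exact] at hc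
    have hc' : Function.Exact (colim.map a) (colim.map b) := hc
    have hn (x) : (localCohomologyObjIso I n S.X₃).hom ((localCohomology I n).map S.g x) =
        colim.map a ((localCohomologyObjIso I n S.X₂).hom x) :=
      ConcreteCategory.congr_hom (localCohomologyObjIso_naturality I n S.g) x
    have hinj {A B : ModuleCat.{u} R} (e : A ≅ B) : Function.Injective e.hom :=
      (ModuleCat.mono_iff_injective _).1 inferInstance
    intro y
    change (localCohomologyObjIso I (n + 1) S.X₁).inv
      (colim.map b ((localCohomologyObjIso I n S.X₃).hom y)) = 0 ↔ _
    refine (map_eq_zero_iff (localCohomologyObjIso I (n + 1) S.X₁).inv.hom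
      (hinj (localCohomologyObjIso I (n + 1) S.X₁).symm)).trans ?_
    rw [hc']
    constructor
    · rintro ⟨x, hx⟩
      refine ⟨(localCohomologyObjIso I n S.X₂).inv x, hinj (localCohomologyObjIso I n S.X₃) ?_⟩
      rw [hn, ← hx]
      simp
    · rintro ⟨x, rfl⟩
      exact ⟨_, (hn x).symm⟩
  · rw [← ModuleCat.epi_iff_surjective]
    have : Epi (colim.map b) := inferInstance
    infer_instance

lemma localCohomology_vanishing (I : Ideal R) (n : ℕ) (J : ModuleCat.{u} R) [Injective J] :
    IsZero ((localCohomology I (n + 1)).obj J) := by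
  refine IsZero.of_iso ?_ (localCohomologyObjIso I (n + 1) J)
  refine colim.map_isZero (Functor.isZero _ fun t => ?_)
  exact isZero_ext_succ_of_injective n _ J

end LocalCohomologyColimit

section ExtZero

variable {R}

open Limits

lemma leftDerived_zero_comp_fromLeftDerivedZero {C D : Type*} [Category C] [Category D]
    [Abelian C] [HasProjectiveResolutions C] [Abelian D] {F G : C ⥤ D} [F.Additive] [G.Additive]
    (α : F ⟶ G) (X : C) :
    (NatTrans.leftDerived α 0).app X ≫ G.fromLeftDerivedZero.app X =
      F.fromLeftDerivedZero.app X ≫ α.app X := by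
  let P := projectiveResolution X
  rw [P.leftDerived_app_eq, P.fromLeftDerivedZero_eq, P.fromLeftDerivedZero_eq]
  simp only [Category.assoc, Iso.inv_hom_id_assoc]
  congr 1
  have h : HomologicalComplex.opcyclesMap
      ((NatTrans.mapHomologicalComplex α (ComplexShape.down ℕ)).app P.complex) 0 ≫
        P.fromLeftDerivedZero' G = P.fromLeftDerivedZero' F ≫ α.app X := by
    rw [← cancel_epi (HomologicalComplex.pOpcycles _ _)]
    rw [HomologicalComplex.p_opcyclesMap_assoc, P.pOpcycles_comp_fromLeftDerivedZero',
      P.pOpcycles_comp_fromLeftDerivedZero'_assoc]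
    exact (α.naturality _).symm
  exact (HomologicalComplex.homologyι_naturality_assoc
    ((NatTrans.mapHomologicalComplex α (ComplexShape.down ℕ)).app P.complex) 0 _).trans
    ((congrArg (fun z => HomologicalComplex.homologyι _ 0 ≫ z) h).trans (Category.assoc _ _ _).symm)

instance preservesFiniteLimits_linearYoneda_obj (N : ModuleCat.{u} R) :
    PreservesFiniteLimits ((linearYoneda R (ModuleCat.{u} R)).obj N) := by
  have : PreservesLimits ((linearYoneda R (ModuleCat.{u} R)).obj N ⋙ forget _) :=
    (inferInstance : PreservesLimits (yoneda.obj N))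
  have : PreservesLimits ((linearYoneda R (ModuleCat.{u} R)).obj N) :=
    preservesLimits_of_reflects_of_preserves _ (forget _)
  infer_instance

instance preservesFiniteColimits_linearYoneda_obj_rightOp (N : ModuleCat.{u} R) :
    PreservesFiniteColimits ((linearYoneda R (ModuleCat.{u} R)).obj N).rightOp :=
  preservesFiniteColimits_rightOp _

/-- `Ext` in degree zero is `Hom`. -/
def extZeroIso (Y : (ModuleCat.{u} R)ᵒᵖ) (N : ModuleCat.{u} R) :
    ((Ext R (ModuleCat.{u} R) 0).obj Y).obj N ≅ ((linearYoneda R (ModuleCat.{u} R)).obj N).obj Y :=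
  (asIso (((linearYoneda R (ModuleCat.{u} R)).obj N).rightOp.fromLeftDerivedZero.app Y.unop)).unop.symm

lemma extZeroIso_naturality_right (Y : (ModuleCat.{u} R)ᵒᵖ) {N N' : ModuleCat.{u} R} (f : N ⟶ N') :
    ((Ext R (ModuleCat.{u} R) 0).obj Y).map f ≫ (extZeroIso Y N').hom =
      (extZeroIso Y N).hom ≫ ((linearYoneda R (ModuleCat.{u} R)).map f).app Y := by
  rw [← Iso.inv_comp_eq, ← Category.assoc, ← Iso.eq_comp_inv]
  exact congrArg Quiver.Hom.unop (leftDerived_zero_comp_fromLeftDerivedZero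
    (NatTrans.rightOp ((linearYoneda R (ModuleCat.{u} R)).map f)) Y.unop)

lemma extZeroIso_naturality_left {Y Y' : (ModuleCat.{u} R)ᵒᵖ} (g : Y ⟶ Y') (N : ModuleCat.{u} R) :
    ((Ext R (ModuleCat.{u} R) 0).map g).app N ≫ (extZeroIso Y' N).hom =
      (extZeroIso Y N).hom ≫ ((linearYoneda R (ModuleCat.{u} R)).obj N).map g := by
  rw [← Iso.inv_comp_eq, ← Category.assoc, ← Iso.eq_comp_inv]
  exact congrArg Quiver.Hom.unop
    (((linearYoneda R (ModuleCat.{u} R)).obj N).rightOp.fromLeftDerivedZero.naturality g.unop)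

end ExtZero

section LocalCohomologyZero

variable {R}

open Limits

/-- Evaluation at `1`. -/
def homEvalOne (J : Ideal R) (N : ModuleCat.{u} R) :
    ((linearYoneda R (ModuleCat.{u} R)).obj N).obj (Opposite.op (ModuleCat.of R (R ⧸ J))) ⟶ N :=
  ModuleCat.ofHom ((LinearMap.applyₗ (R := R) (Ideal.Quotient.mk J 1)).comp
    (ModuleCat.homLinearEquiv (S := R) (M := ModuleCat.of R (R ⧸ J)) (N := N)).toLinearMap)

/-- Evaluation at `1` as a natural transformation `Ext^0(R/J, N) ⟶ N`. -/
def extZeroEval (J : Ideal R) :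
    (Ext R (ModuleCat.{u} R) 0).obj (Opposite.op (ModuleCat.of R (R ⧸ J))) ⟶
      𝟭 (ModuleCat.{u} R) where
  app N := (extZeroIso (Opposite.op (ModuleCat.of R (R ⧸ J))) N).hom ≫ homEvalOne J N
  naturality N N' f := by
    refine (Category.assoc _ _ _).symm.trans ?_
    rw [extZeroIso_naturality_right, Category.assoc]
    exact (Category.assoc _ _ _).symm

lemma extZeroEval_app_injective (J : Ideal R) (N : ModuleCat.{u} R) :
    Function.Injective ((extZeroEval J).app N) := by
  have h1 : Function.Injective (extZeroIso (Opposite.op (ModuleCat.of R (R ⧸ J))) N).hom :=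
    (ModuleCat.mono_iff_injective _).1 inferInstance
  refine Function.Injective.comp (f := (extZeroIso (Opposite.op (ModuleCat.of R (R ⧸ J))) N).hom)
    (g := fun f : ModuleCat.of R (R ⧸ J) ⟶ N => f (Ideal.Quotient.mk J 1)) ?_ h1
  intro f g (h : f _ = g _)
  refine ModuleCat.hom_ext (LinearMap.ext fun x => ?_)
  obtain ⟨r, rfl⟩ := Ideal.Quotient.mk_surjective x
  have hr : Ideal.Quotient.mk J r = r • (Ideal.Quotient.mk J 1) := by
    rw [← Ideal.Quotient.mk_eq_mk, ← Ideal.Quotient.mk_eq_mk, ← Submodule.Quotient.mk_smul]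
    simp
  change f.hom _ = g.hom _
  rw [hr, map_smul, map_smul]
  exact congrArg (r • ·) h

lemma extZeroEval_app_range (J : Ideal R) (N : ModuleCat.{u} R) (x : N) :
    (∃ y, (extZeroEval J).app N y = x) ↔ ∀ r ∈ J, r • x = 0 := by
  constructor
  · rintro ⟨y, rfl⟩ r hr
    let f : (R ⧸ J) →ₗ[R] N :=
      ModuleCat.homLinearEquiv (S := R) (M := ModuleCat.of R (R ⧸ J)) (N := N)
        ((extZeroIso (Opposite.op (ModuleCat.of R (R ⧸ J))) N).hom y)
    change r • f (Ideal.Quotient.mk J 1) = 0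
    rw [← map_smul, ← Ideal.Quotient.mk_eq_mk, ← Submodule.Quotient.mk_smul, smul_eq_mul, mul_one,
      Ideal.Quotient.mk_eq_mk, Ideal.Quotient.eq_zero_iff_mem.2 hr, map_zero]
  · intro h
    let f : (R ⧸ J) →ₗ[R] N := Submodule.liftQ J (LinearMap.toSpanSingleton R N x) h
    let f' : ((linearYoneda R (ModuleCat.{u} R)).obj N).obj
      (Opposite.op (ModuleCat.of R (R ⧸ J))) := ModuleCat.ofHom f
    refine ⟨(extZeroIso (Opposite.op (ModuleCat.of R (R ⧸ J))) N).inv f', ?_⟩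
    have h2 := ConcreteCategory.congr_hom
      (extZeroIso (Opposite.op (ModuleCat.of R (R ⧸ J))) N).inv_hom_id f'
    refine (congrArg (fun g => homEvalOne J N g) h2).trans ?_
    change (1 : R) • x = x
    exact one_smul _ _

/-- The cocone over the system of functors `Ext^0(R/I^t, -)` with point the identity functor. -/
def extZeroCocone (I : Ideal R) :
    Cocone (localCohomology.diagram (localCohomology.idealPowersDiagram I) 0) where
  pt := 𝟭 _
  ι :=
    { app := fun t => extZeroEval ((localCohomology.idealPowersDiagram I).obj t.unop)
      naturality := fun t t' g => by
        ext N : 2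
        refine (Category.assoc _ _ _).symm.trans ?_
        refine (congrArg (· ≫ homEvalOne _ N) (extZeroIso_naturality_left _ N)).trans ?_
        rfl }

theorem isTorsionCohomology_localCohomology (I : Ideal R) :
    IsTorsionCohomology I (fun n => localCohomology I n) where
  connecting S hS _ n := localCohomology_connecting I hS n
  vanishing n J _ := localCohomology_vanishing I n J
  zero := by
    let F := localCohomology.diagram (localCohomology.idealPowersDiagram I) 0
    let ε : localCohomology I 0 ⟶ 𝟭 _ := colimit.desc F (extZeroCocone I)
    refine ⟨ε, fun N => ?_⟩
    let G : (ℕᵒᵖ)ᵒᵖ ⥤ ModuleCat.{u} R := F ⋙ (evaluation (ModuleCat.{u} R) (ModuleCat.{u} R)).obj N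
    let c : Cocone G := ((evaluation (ModuleCat.{u} R) (ModuleCat.{u} R)).obj N).mapCocone
      (colimit.cocone F)
    have hc : IsColimit c := isColimitOfPreserves _ (colimit.isColimit F)
    have hι (t : (ℕᵒᵖ)ᵒᵖ) (z : G.obj t) : ε.app N (c.ι.app t z) =
        (extZeroEval ((localCohomology.idealPowersDiagram I).obj t.unop)).app N z := by
      have := congrArg (fun α => NatTrans.app α N) (colimit.ι_desc (extZeroCocone I) t)
      exact ConcreteCategory.congr_hom this z
    have : PreservesFilteredColimitsOfSize.{0, 0} (forget (ModuleCat.{u} R)) :=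
      preservesSmallestFilteredColimits_of_preservesFilteredColimits _
    have : PreservesColimit G (forget (ModuleCat.{u} R)) := inferInstance
    constructor
    · rw [← LinearMap.ker_eq_bot (f := (ε.app N).hom), LinearMap.ker_eq_bot']
      intro y hy
      obtain ⟨t, z, rfl⟩ := Concrete.isColimit_exists_rep G hc y
      have h0 : (extZeroEval ((localCohomology.idealPowersDiagram I).obj t.unop)).app N z = 0 :=
        (hι t z).symm.trans hy
      have hz : z = 0 := extZeroEval_app_injective _ N (h0.trans (map_zero _).symm)
      rw [hz]
      exact map_zero _
    · intro x
      constructor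
      · rintro ⟨y, rfl⟩
        obtain ⟨t, z, rfl⟩ := Concrete.isColimit_exists_rep G hc y
        refine ⟨t.unop.unop, ?_⟩
        exact (extZeroEval_app_range _ N _).1 ⟨z, (hι t z).symm⟩
      · rintro ⟨t, ht⟩
        obtain ⟨z, hz⟩ := (extZeroEval_app_range ((localCohomology.idealPowersDiagram I).obj
          (Opposite.op t)) N x).2 ht
        exact ⟨c.ι.app (Opposite.op (Opposite.op t)) z, (hι _ z).trans hz⟩

end LocalCohomologyZero

section DiffModules

variable {R}

variable (R) in
/-- A bounded cochain complex of `R`-modules, presented as a module with a differential together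
with the projections onto its homogeneous components. -/
structure DiffModule : Type (u + 1) where
  carrier : Type u
  [addCommGroup : AddCommGroup carrier]
  [module : Module R carrier]
  d : carrier →ₗ[R] carrier
  p : ℤ → carrier →ₗ[R] carrier
  d_d : ∀ x, d (d x) = 0
  d_p : ∀ n x, d (p n x) = p (n + 1) (d x)
  p_p_self : ∀ n x, p n (p n x) = p n x
  p_p_ne : ∀ n m x, n ≠ m → p n (p m x) = 0
  sum_p : ∃ S : Finset ℤ, ∀ x, ∑ n ∈ S, p n x = x

namespace DiffModule

instance : CoeSort (DiffModule R) (Type u) := ⟨carrier⟩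

attribute [instance] addCommGroup module

/-- Morphisms of complexes. -/
@[ext]
structure Hom (A B : DiffModule R) where
  f : A →ₗ[R] B
  f_d : ∀ x, f (A.d x) = B.d (f x)
  f_p : ∀ n x, f (A.p n x) = B.p n (f x)

/-- Short exact sequences of complexes. -/
structure ShortExact {A B C : DiffModule R} (f : Hom A B) (g : Hom B C) : Prop where
  inj : Function.Injective f.f
  exact : Function.Exact f.f g.f
  surj : Function.Surjective g.f

/-- Acyclic complexes. -/
def IsAcyclic (A : DiffModule R) : Prop := ∀ z, A.d z = 0 → ∃ y, A.d y = z

/-- The cocycles of degree `n`. -/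
def Z (A : DiffModule R) (n : ℤ) : Submodule R A :=
  LinearMap.ker A.d ⊓ LinearMap.eqLocus (A.p n) LinearMap.id

lemma mem_Z {A : DiffModule R} {n : ℤ} {x : A} : x ∈ A.Z n ↔ A.d x = 0 ∧ A.p n x = x := Iff.rfl

/-- The cohomology in degree `n`. -/
abbrev H (A : DiffModule R) (n : ℤ) : Type u :=
  A.Z n ⧸ (LinearMap.range A.d).comap (A.Z n).subtype

/-- The cohomology class of a cocycle. -/
abbrev cls (A : DiffModule R) (n : ℤ) : A.Z n →ₗ[R] A.H n := Submodule.mkQ _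

lemma cls_eq_zero {A : DiffModule R} {n : ℤ} {z : A.Z n} :
    A.cls n z = 0 ↔ ∃ y, A.d y = z := by
  rw [← LinearMap.mem_ker, Submodule.ker_mkQ]
  rfl

lemma cls_surjective (A : DiffModule R) (n : ℤ) : Function.Surjective (A.cls n) :=
  Submodule.mkQ_surjective _

lemma exists_d_eq {A : DiffModule R} {n : ℤ} {x : A} (hx : A.p (n + 1) x = x)
    (h : ∃ y, A.d y = x) : ∃ y, A.d y = x ∧ A.p n y = y := by
  obtain ⟨y, rfl⟩ := h
  exact ⟨A.p n y, by rw [A.d_p, hx], A.p_p_self n y⟩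

lemma IsAcyclic.subsingleton {A : DiffModule R} (hA : A.IsAcyclic) (n : ℤ) :
    Subsingleton (A.H n) := by
  refine ⟨fun a b => ?_⟩
  have (a : A.H n) : a = 0 := by
    obtain ⟨z, rfl⟩ := A.cls_surjective n a
    exact cls_eq_zero.2 (hA z z.2.1)
  rw [this a, this b]

namespace Hom

variable {A B C : DiffModule R}

/-- The map induced on cocycles. -/
def mapZ (f : Hom A B) (n : ℤ) : A.Z n →ₗ[R] B.Z n :=
  f.f.restrict fun x hx => by
    rw [mem_Z] at hx ⊢
    rw [← f.f_d, hx.1, map_zero, ← f.f_p, hx.2]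
    exact ⟨rfl, rfl⟩

/-- The map induced on cohomology. -/
def map (f : Hom A B) (n : ℤ) : A.H n →ₗ[R] B.H n :=
  Submodule.mapQ _ _ (f.mapZ n) (by
    rintro x ⟨y, hy⟩
    exact ⟨f.f y, by rw [← f.f_d, hy]; rfl⟩)

lemma map_cls (f : Hom A B) (n : ℤ) (z : A.Z n) : f.map n (A.cls n z) = B.cls n (f.mapZ n z) := rfl

end Hom

namespace ShortExact

variable {A B C : DiffModule R} {f : Hom A B} {g : Hom B C}

lemma exists_lift (h : ShortExact f g) {n : ℤ} {z : C} (hz : C.p n z = z) :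
    ∃ y, g.f y = z ∧ B.p n y = y := by
  obtain ⟨y, rfl⟩ := h.surj z
  exact ⟨B.p n y, by rw [g.f_p, hz], B.p_p_self n y⟩

lemma exists_preimage (h : ShortExact f g) {n : ℤ} {y : B} (hy : B.p n y = y) (h0 : g.f y = 0) :
    ∃ x, f.f x = y ∧ A.p n x = x := by
  obtain ⟨x, rfl⟩ := (h.exact y).1 h0
  exact ⟨x, rfl, h.inj (by rw [f.f_p, hy])⟩

lemma comp_apply (h : ShortExact f g) (x : A) : g.f (f.f x) = 0 := (h.exact _).2 ⟨x, rfl⟩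

lemma exact_map (h : ShortExact f g) (n : ℤ) : Function.Exact (f.map n) (g.map n) := by
  intro b
  constructor
  · obtain ⟨z, rfl⟩ := B.cls_surjective n b
    intro h0
    rw [Hom.map_cls, cls_eq_zero] at h0
    obtain ⟨w, hw⟩ := h0
    obtain ⟨v, hv⟩ := h.surj w
    obtain ⟨m, rfl⟩ : ∃ m, n = m + 1 := ⟨n - 1, by omega⟩
    have hz := mem_Z.1 z.2
    obtain ⟨x, hx, hxp⟩ := h.exists_preimage (n := m + 1) (y := z - B.d (B.p m v))
      (by rw [map_sub, hz.2, ← B.d_p, B.p_p_self]) (by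
        rw [map_sub, g.f_d, g.f_p, hv, C.d_p, hw]
        change g.f z.1 - C.p _ (g.f z.1) = 0
        rw [← g.f_p, hz.2, sub_self])
    have hxd : A.d x = 0 := h.inj (by rw [f.f_d, hx, map_sub, hz.1, B.d_d, map_zero, sub_zero])
    refine ⟨A.cls _ ⟨x, hxd, hxp⟩, ?_⟩
    rw [Hom.map_cls, ← sub_eq_zero, ← map_sub, cls_eq_zero]
    refine ⟨B.p m (-v), ?_⟩
    change _ = f.f x - z.1
    rw [hx, map_neg, map_neg]
    abel
  · rintro ⟨a, rfl⟩
    obtain ⟨z, rfl⟩ := A.cls_surjective n a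
    rw [Hom.map_cls, Hom.map_cls, cls_eq_zero]
    exact ⟨0, (map_zero _).trans (h.comp_apply z.1).symm⟩

lemma exists_connecting (h : ShortExact f g) (n : ℤ) :
    ∃ δ : C.H n →ₗ[R] A.H (n + 1),
      Function.Exact (g.map n) δ ∧ Function.Exact δ (f.map (n + 1)) := by
  let W : Submodule R (B × A) := LinearMap.eqLocus (B.d.comp (LinearMap.fst R B A))
      (f.f.comp (LinearMap.snd R B A)) ⊓ ((LinearMap.eqLocus (B.p n) LinearMap.id).prod
        (LinearMap.eqLocus (A.p (n + 1)) LinearMap.id))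
  have hW (w : W) : B.d w.1.1 = f.f w.1.2 ∧ B.p n w.1.1 = w.1.1 ∧ A.p (n + 1) w.1.2 = w.1.2 := w.2
  let a : W →ₗ[R] C.Z n := LinearMap.codRestrict _
    ((g.f.comp (LinearMap.fst R B A)).comp W.subtype) fun w => by
      refine mem_Z.2 ⟨?_, ?_⟩
      · change C.d (g.f w.1.1) = 0
        rw [← g.f_d, (hW w).1, h.comp_apply]
      · change C.p n (g.f w.1.1) = g.f w.1.1
        rw [← g.f_p, (hW w).2.1]
  let b : W →ₗ[R] A.Z (n + 1) := LinearMap.codRestrict _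
    ((LinearMap.snd R B A).comp W.subtype) fun w => by
      refine mem_Z.2 ⟨h.inj ?_, (hW w).2.2⟩
      change f.f (A.d w.1.2) = _
      rw [f.f_d, ← (hW w).1, B.d_d, map_zero]
  let φ : W →ₗ[R] C.H n := (C.cls n).comp a
  let ψ : W →ₗ[R] A.H (n + 1) := (A.cls (n + 1)).comp b
  have hφ : Function.Surjective φ := by
    intro c
    obtain ⟨z, rfl⟩ := C.cls_surjective n c
    have hz := mem_Z.1 z.2
    obtain ⟨y, hy, hyp⟩ := h.exists_lift hz.2
    obtain ⟨x, hx, hxp⟩ := h.exists_preimage (n := n + 1) (y := B.d y) (by rw [← B.d_p, hyp])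
      (by rw [g.f_d, hy, hz.1])
    exact ⟨⟨(y, x), hx.symm, hyp, hxp⟩, congrArg (C.cls n) (Subtype.ext hy)⟩
  have hψ (w : W) : ψ w = 0 ↔ ∃ y, A.d y = w.1.2 := cls_eq_zero
  have hφ0 (w : W) : φ w = 0 ↔ ∃ y, C.d y = g.f w.1.1 := cls_eq_zero
  have hker : LinearMap.ker φ ≤ LinearMap.ker ψ := by
    intro w hw
    rw [LinearMap.mem_ker] at hw ⊢
    obtain ⟨y, hy⟩ := (hφ0 w).1 hw
    obtain ⟨v, rfl⟩ := h.surj y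
    obtain ⟨x, hx⟩ := (h.exact (w.1.1 - B.d v)).1 (by rw [map_sub, g.f_d, hy, sub_self])
    exact (hψ w).2 ⟨x, h.inj (by rw [f.f_d, hx, map_sub, B.d_d, sub_zero, (hW w).1])⟩
  let δ : C.H n →ₗ[R] A.H (n + 1) :=
    (LinearMap.ker φ).liftQ ψ hker ∘ₗ (φ.quotKerEquivOfSurjective hφ).symm.toLinearMap
  have hδ (w : W) : δ (φ w) = ψ w := by
    have : (φ.quotKerEquivOfSurjective hφ).symm (φ w) = Submodule.Quotient.mk w :=
      (LinearEquiv.symm_apply_eq _).2 rfl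
    change (LinearMap.ker φ).liftQ ψ hker ((φ.quotKerEquivOfSurjective hφ).symm (φ w)) = _
    rw [this]
    rfl
  refine ⟨δ, fun c => ?_, fun e => ?_⟩
  · obtain ⟨w, rfl⟩ := hφ c
    rw [hδ, hψ]
    constructor
    · intro hy
      obtain ⟨y, hy, hyp⟩ := exists_d_eq (hW w).2.2 hy
      refine ⟨B.cls n ⟨w.1.1 - f.f y, ?_, ?_⟩, ?_⟩
      · change B.d _ = 0
        rw [map_sub, ← f.f_d, hy, (hW w).1, sub_self]
      · change B.p n _ = _
        rw [map_sub, ← f.f_p, hyp, (hW w).2.1]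
        rfl
      · rw [Hom.map_cls]
        refine congrArg (C.cls n) (Subtype.ext ?_)
        change g.f (_ - _) = g.f _
        rw [map_sub, h.comp_apply, sub_zero]
        rfl
    · rintro ⟨b', hb⟩
      obtain ⟨z, rfl⟩ := B.cls_surjective n b'
      have hz := mem_Z.1 z.2
      have hw : φ (w - ⟨(z.1, 0), hz.1.trans (map_zero f.f).symm,
        hz.2, map_zero _⟩) = 0 := by
        rw [map_sub, sub_eq_zero, ← hb]
        rfl
      have := (hψ _).1 (hker hw)
      simpa using this
  · constructor
    · obtain ⟨z, rfl⟩ := A.cls_surjective _ e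
      intro hz
      rw [Hom.map_cls, cls_eq_zero] at hz
      have hz' := mem_Z.1 z.2
      obtain ⟨y, hy, hyp⟩ := exists_d_eq (n := n) (mem_Z.1 (f.mapZ (n + 1) z).2).2 hz
      exact ⟨φ ⟨(y, z.1), hy, hyp, hz'.2⟩, hδ _⟩
    · rintro ⟨c, rfl⟩
      obtain ⟨w, rfl⟩ := hφ c
      rw [hδ]
      refine (cls_eq_zero (z := f.mapZ (n + 1) (b w))).2 ⟨w.1.1, (hW w).1⟩

lemma bijective_of_acyclic_left (h : ShortExact f g) (hA : A.IsAcyclic) (n : ℤ) :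
    Function.Bijective (g.map n) := by
  have := hA.subsingleton
  obtain ⟨δ, h1, -⟩ := h.exists_connecting n
  refine ⟨?_, fun c => (h1 c).1 (Subsingleton.elim _ _)⟩
  rw [injective_iff_map_eq_zero]
  intro b hb
  obtain ⟨a, rfl⟩ := (h.exact_map n b).1 hb
  rw [Subsingleton.elim a 0, map_zero]

lemma bijective_of_acyclic_right (h : ShortExact f g) (hC : C.IsAcyclic) (n : ℤ) :
    Function.Bijective (f.map n) := by
  have := hC.subsingleton
  obtain ⟨m, rfl⟩ : ∃ m, n = m + 1 := ⟨n - 1, by omega⟩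
  obtain ⟨δ, -, h2⟩ := h.exists_connecting m
  refine ⟨?_, fun b => (h.exact_map _ b).1 (Subsingleton.elim _ _)⟩
  rw [injective_iff_map_eq_zero]
  intro b hb
  obtain ⟨a, rfl⟩ := (h2 b).1 hb
  rw [Subsingleton.elim a 0, map_zero]

end ShortExact

end DiffModule

end DiffModules

section Localization

variable {R}

/-- The localization of `M` at the powers of `x`. -/
abbrev Loc (x : R) (M : Type u) [AddCommGroup M] [Module R M] : Type u :=
  LocalizedModule (Submonoid.powers x) M

variable {M N N' : Type u} [AddCommGroup M] [Module R M] [AddCommGroup N] [Module R N]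
  [AddCommGroup N'] [Module R N']

/-- The fraction `m / x ^ k`. -/
def frac (x : R) (m : M) (k : ℕ) : Loc x M := LocalizedModule.mk m ⟨x ^ k, k, rfl⟩

lemma exists_frac {x : R} (y : Loc x M) : ∃ m k, y = frac x m k := by
  induction y using LocalizedModule.induction_on with
  | _ m s =>
    obtain ⟨_, k, rfl⟩ := s
    exact ⟨m, k, rfl⟩

lemma frac_eq_frac {x : R} {m m' : M} {k k' : ℕ} :
    frac x m k = frac x m' k' ↔ ∃ l, x ^ (l + k') • m = x ^ (l + k) • m' := by
  rw [frac, frac, LocalizedModule.mk_eq]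
  simp only [Subtype.exists, Submonoid.mem_powers_iff, Submonoid.smul_def, smul_smul, pow_add]
  constructor
  · rintro ⟨_, ⟨l, rfl⟩, h⟩
    exact ⟨l, h⟩
  · rintro ⟨l, h⟩
    exact ⟨_, ⟨l, rfl⟩, h⟩

lemma frac_zero (x : R) (k : ℕ) : frac x (0 : M) k = 0 := LocalizedModule.zero_mk _

lemma frac_eq_zero {x : R} {m : M} {k : ℕ} : frac x m k = 0 ↔ ∃ l, x ^ l • m = 0 := by
  rw [← frac_zero x 0, frac_eq_frac]
  simp

lemma frac_pow_smul (x : R) (m : M) (k l : ℕ) : frac x (x ^ l • m) (k + l) = frac x m k := by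
  rw [frac_eq_frac]
  exact ⟨0, by rw [smul_smul]; congr 1; ring⟩

lemma smul_frac (x r : R) (m : M) (k : ℕ) : r • frac x m k = frac x (r • m) k :=
  LocalizedModule.smul'_mk _ _ _

lemma frac_add_frac (x : R) (m m' : M) (k : ℕ) : frac x m k + frac x m' k = frac x (m + m') k := by
  rw [frac, frac, LocalizedModule.mk_add_mk, ← smul_add]
  exact LocalizedModule.mk_cancel_common_left _ _ _

lemma exists_frac₂ {x : R} (y z : Loc x M) : ∃ m n k, y = frac x m k ∧ z = frac x n k := by
  obtain ⟨m, k, rfl⟩ := exists_frac y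
  obtain ⟨n, l, rfl⟩ := exists_frac z
  exact ⟨x ^ l • m, x ^ k • n, k + l, (frac_pow_smul ..).symm,
    by rw [add_comm]; exact (frac_pow_smul ..).symm⟩

/-- The localization map. -/
abbrev toLoc (x : R) (M : Type u) [AddCommGroup M] [Module R M] : M →ₗ[R] Loc x M :=
  LocalizedModule.mkLinearMap _ M

lemma toLoc_apply (x : R) (m : M) : toLoc x M m = frac x m 0 := by
  exact congrArg (LocalizedModule.mk m) (Subtype.ext (pow_zero x).symm)

/-- The map of localizations induced by a linear map. -/
def locMap (x : R) : (M →ₗ[R] N) →ₗ[R] (Loc x M →ₗ[R] Loc x N) :=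
  IsLocalizedModule.map (Submonoid.powers x) (toLoc x M) (toLoc x N)

@[simp]
lemma locMap_frac (x : R) (f : M →ₗ[R] N) (m : M) (k : ℕ) :
    locMap x f (frac x m k) = frac x (f m) k :=
  IsLocalizedModule.map_LocalizedModules _ f m _

lemma locMap_toLoc (x : R) (f : M →ₗ[R] N) (m : M) :
    locMap x f (toLoc x M m) = toLoc x N (f m) := by
  rw [toLoc_apply, toLoc_apply, locMap_frac]

lemma locMap_id (x : R) (y : Loc x M) : locMap x LinearMap.id y = y := by
  obtain ⟨m, k, rfl⟩ := exists_frac y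
  simp

lemma locMap_comm {P : Type u} [AddCommGroup P] [Module R P] (x : R) {f : M →ₗ[R] N}
    {g : N →ₗ[R] N'} {f' : M →ₗ[R] P} {g' : P →ₗ[R] N'} (h : ∀ m, g (f m) = g' (f' m))
    (y : Loc x M) : locMap x g (locMap x f y) = locMap x g' (locMap x f' y) := by
  obtain ⟨m, k, rfl⟩ := exists_frac y
  simp [h]

lemma exists_pow_smul_eq (x : R) (y : Loc x M) : ∃ z, x • z = y := by
  obtain ⟨m, k, rfl⟩ := exists_frac y
  refine ⟨frac x m (k + 1), ?_⟩
  rw [smul_frac, ← frac_pow_smul x m k 1, pow_one]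

lemma eq_zero_of_smul_eq_zero (x : R) {y : Loc x M} (h : x • y = 0) : y = 0 := by
  obtain ⟨m, k, rfl⟩ := exists_frac y
  rw [smul_frac, frac_eq_zero] at h
  obtain ⟨l, hl⟩ := h
  exact frac_eq_zero.2 ⟨l + 1, by rw [pow_succ, mul_smul, hl]⟩

end Localization

section Cone

variable {R}

namespace DiffModule

lemma p_eq_zero {A : DiffModule R} {S : Finset ℤ} (hS : ∀ x, ∑ n ∈ S, A.p n x = x) {n : ℤ}
    (hn : n ∉ S) (x : A) : A.p n x = 0 := by
  rw [← hS x, map_sum]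
  exact Finset.sum_eq_zero fun m hm => A.p_p_ne _ _ _ fun h => hn (h ▸ hm)

lemma sum_p_of_subset {A : DiffModule R} {S T : Finset ℤ} (hS : ∀ x, ∑ n ∈ S, A.p n x = x)
    (h : S ⊆ T) (x : A) : ∑ n ∈ T, A.p n x = x := by
  refine (Finset.sum_subset h fun n _ hn => p_eq_zero hS hn x).symm.trans (hS x)

/-- The localization of a complex at the powers of `x`, shifted by one. -/
def loc (x : R) (A : DiffModule R) : DiffModule R where
  carrier := Loc x A
  d := -locMap x A.d
  p n := locMap x (A.p (n - 1))
  d_d y := by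
    obtain ⟨m, k, rfl⟩ := exists_frac y
    simp [A.d_d, frac_zero]
  d_p n y := by
    obtain ⟨m, k, rfl⟩ := exists_frac y
    simp [A.d_p]
  p_p_self n y := by
    obtain ⟨m, k, rfl⟩ := exists_frac y
    simp [A.p_p_self]
  p_p_ne n m y h := by
    obtain ⟨m, k, rfl⟩ := exists_frac y
    rw [locMap_frac, locMap_frac, A.p_p_ne _ _ _ (by omega), frac_zero]
  sum_p := by
    obtain ⟨S, hS⟩ := A.sum_p
    refine ⟨S.map (addRightEmbedding 1), fun y => ?_⟩
    rw [Finset.sum_map]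
    simp only [addRightEmbedding_apply, add_sub_cancel_right]
    rw [← LinearMap.sum_apply, ← map_sum]
    convert locMap_id x y
    ext a
    simp [hS]

/-- The fibre of the localization map of a complex at the powers of `x`. -/
def cone (x : R) (A : DiffModule R) : DiffModule R where
  carrier := A × Loc x A
  d := (A.d.comp (LinearMap.fst R _ _)).prod
    ((toLoc x A).comp (LinearMap.fst R _ _) - (locMap x A.d).comp (LinearMap.snd R _ _))
  p n := (A.p n).prodMap (locMap x (A.p (n - 1)))
  d_d y := by
    refine Prod.ext (A.d_d _) ?_
    have h : locMap x A.d (locMap x A.d y.2) = 0 := by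
      obtain ⟨m, k, hk⟩ := exists_frac y.2
      rw [hk, locMap_frac, locMap_frac, A.d_d, frac_zero]
    change toLoc x A (A.d y.1) - locMap x A.d (toLoc x A y.1 - locMap x A.d y.2) = 0
    rw [map_sub, h, locMap_toLoc, sub_zero, sub_self]
  d_p n y := by
    refine Prod.ext (A.d_p _ _) ?_
    change toLoc x A (A.p n y.1) - locMap x A.d (locMap x (A.p (n - 1)) y.2) =
      locMap x (A.p (n + 1 - 1)) (toLoc x A y.1 - locMap x A.d y.2)
    rw [map_sub, locMap_toLoc, add_sub_cancel_right]
    congr 1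
    exact locMap_comm x (fun m => by rw [A.d_p, sub_add_cancel]) _
  p_p_self n y := Prod.ext (A.p_p_self n _) ((loc x A).p_p_self n _)
  p_p_ne n m y h := Prod.ext (A.p_p_ne n m _ h) ((loc x A).p_p_ne n m _ h)
  sum_p := by
    obtain ⟨S, hS⟩ := A.sum_p
    obtain ⟨T, hT⟩ := (loc x A).sum_p
    refine ⟨S ∪ T, fun y => ?_⟩
    refine Prod.ext ?_ ?_
    · rw [Prod.fst_sum]
      exact sum_p_of_subset hS Finset.subset_union_left y.1
    · rw [Prod.snd_sum]
      exact sum_p_of_subset hT Finset.subset_union_right y.2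

lemma cone_d (x : R) (A : DiffModule R) (a : A) (u : Loc x A) :
    (cone x A).d (a, u) = (A.d a, toLoc x A a - locMap x A.d u) := rfl

lemma cone_p (x : R) (A : DiffModule R) (n : ℤ) (a : A) (u : Loc x A) :
    (cone x A).p n (a, u) = (A.p n a, locMap x (A.p (n - 1)) u) := rfl

/-- The projection of the cone onto the original complex. -/
def coneFst (x : R) (A : DiffModule R) : Hom (cone x A) A where
  f := LinearMap.fst R _ _
  f_d _ := rfl
  f_p _ _ := rfl

/-- The inclusion of the shifted localization in the cone. -/
def coneInr (x : R) (A : DiffModule R) : Hom (loc x A) (cone x A) where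
  f := LinearMap.inr R _ _
  f_d u := by
    refine Prod.ext (map_zero A.d).symm ?_
    change -locMap x A.d u = toLoc x A 0 - locMap x A.d u
    rw [map_zero, zero_sub]
  f_p n u := Prod.ext (map_zero (A.p n)).symm rfl

lemma shortExact_cone (x : R) (A : DiffModule R) : ShortExact (coneInr x A) (coneFst x A) where
  inj := LinearMap.inr_injective
  exact := LinearMap.exact_iff.2 (LinearMap.range_inr R _ _).symm
  surj := LinearMap.fst_surjective

namespace Hom

variable {A B C : DiffModule R}

/-- Functoriality of the cone. -/
def cone (x : R) (f : Hom A B) : Hom (A.cone x) (B.cone x) where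
  f := f.f.prodMap (locMap x f.f)
  f_d := by
    rintro ⟨a, u⟩
    refine Prod.ext (f.f_d a) ?_
    change locMap x f.f (toLoc x A a - locMap x A.d u) =
      toLoc x B (f.f a) - locMap x B.d (locMap x f.f u)
    rw [map_sub, locMap_toLoc, locMap_comm x f.f_d]
  f_p n := by
    rintro ⟨a, u⟩
    exact Prod.ext (f.f_p n a) (locMap_comm x (f.f_p (n - 1)) u)

end Hom

lemma ShortExact.cone {A B C : DiffModule R} {f : Hom A B} {g : Hom B C} (h : ShortExact f g)
    (x : R) : ShortExact (f.cone x) (g.cone x) where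
  inj := h.inj.prodMap (IsLocalizedModule.map_injective _ _ _ _ h.inj)
  exact := by
    have h1 := h.exact
    have h2 : Function.Exact (locMap x f.f) (locMap x g.f) :=
      IsLocalizedModule.map_exact _ _ _ _ _ _ h.exact
    rintro ⟨b, u⟩
    change ((g.f b, locMap x g.f u) : C × Loc x C) = 0 ↔ _
    rw [Prod.mk_eq_zero, h1 b, h2 u]
    constructor
    · rintro ⟨⟨a, rfl⟩, v, rfl⟩
      exact ⟨(a, v), rfl⟩
    · rintro ⟨⟨a, v⟩, hav⟩
      exact ⟨⟨a, congrArg Prod.fst hav⟩, v, congrArg Prod.snd hav⟩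
  surj := h.surj.prodMap (IsLocalizedModule.map_surjective _ _ _ _ h.surj)

lemma IsAcyclic.exists_loc {A : DiffModule R} (hA : A.IsAcyclic) (x : R) (u : Loc x A)
    (hu : locMap x A.d u = 0) : ∃ v, locMap x A.d v = u := by
  obtain ⟨m, k, rfl⟩ := exists_frac u
  rw [locMap_frac, frac_eq_zero] at hu
  obtain ⟨l, hl⟩ := hu
  obtain ⟨w, hw⟩ := hA (x ^ l • m) (by rw [map_smul, hl])
  exact ⟨frac x w (k + l), by rw [locMap_frac, hw, frac_pow_smul]⟩

lemma isAcyclic_cone_of {A : DiffModule R} {x : R}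
    (h : ∀ (a : A) (u : Loc x A), A.d a = 0 → toLoc x A a = locMap x A.d u →
      ∃ (b : A) (v : Loc x A), A.d b = a ∧ toLoc x A b - locMap x A.d v = u) :
    (cone x A).IsAcyclic := by
  rintro ⟨a, u⟩ hz
  rw [cone_d] at hz
  obtain ⟨b, v, hb, hv⟩ := h a u (congrArg Prod.fst hz) (sub_eq_zero.1 (congrArg Prod.snd hz))
  exact ⟨(b, v), by rw [cone_d, hb, hv]⟩

lemma IsAcyclic.cone {A : DiffModule R} (hA : A.IsAcyclic) (x : R) : (A.cone x).IsAcyclic := by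
  refine isAcyclic_cone_of fun a u ha hu => ?_
  obtain ⟨b, rfl⟩ := hA a ha
  obtain ⟨v, hv⟩ := hA.exists_loc x (toLoc x A b - u)
    (by rw [map_sub, locMap_toLoc, hu, sub_self])
  exact ⟨b, v, rfl, by rw [hv, sub_sub_cancel]⟩

/-- The cone is acyclic if `x` acts bijectively. -/
lemma isAcyclic_cone_of_bijective {A : DiffModule R} {x : R}
    (hx : Function.Bijective fun a : A => x • a) : (A.cone x).IsAcyclic := by
  have hinj (l : ℕ) (a : A) (h : x ^ l • a = 0) : a = 0 := by
    induction l with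
    | zero => simpa using h
    | succ l ih =>
      rw [pow_succ', mul_smul] at h
      exact ih (hx.1 (h.trans (smul_zero x).symm))
  have hsurj (l : ℕ) (a : A) : ∃ b, x ^ l • b = a := by
    induction l with
    | zero => exact ⟨a, by simp⟩
    | succ l ih =>
      obtain ⟨b, rfl⟩ := ih
      obtain ⟨c, rfl⟩ := hx.2 b
      exact ⟨c, by rw [pow_succ, mul_smul]⟩
  refine isAcyclic_cone_of fun a u ha hu => ?_
  obtain ⟨m, k, rfl⟩ := exists_frac u
  obtain ⟨b, rfl⟩ := hsurj k m
  have e : frac x (x ^ k • b) k = toLoc x A b := by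
    rw [toLoc_apply, ← frac_pow_smul x b 0 k, zero_add]
  rw [e, locMap_toLoc, ← sub_eq_zero, ← map_sub, toLoc_apply, frac_eq_zero] at hu
  obtain ⟨l, hl⟩ := hu
  exact ⟨b, 0, (sub_eq_zero.1 (hinj l _ hl)).symm, by rw [e, map_zero, sub_zero]⟩

/-- The iterated cone along a list of elements. -/
def coneL : List R → DiffModule R → DiffModule R
  | [], A => A
  | x :: L, A => coneL L (cone x A)

/-- Functoriality of the iterated cone. -/
def Hom.coneL : (L : List R) → {A B : DiffModule R} → Hom A B → Hom (A.coneL L) (B.coneL L)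
  | [], _, _, f => f
  | x :: L, _, _, f => Hom.coneL L (f.cone x)

lemma ShortExact.coneL (L : List R) {A B C : DiffModule R} {f : Hom A B} {g : Hom B C}
    (h : ShortExact f g) : ShortExact (f.coneL L) (g.coneL L) := by
  induction L generalizing A B C with
  | nil => exact h
  | cons x L ih => exact ih (h.cone x)

lemma IsAcyclic.coneL (L : List R) {A : DiffModule R} (hA : A.IsAcyclic) :
    (A.coneL L).IsAcyclic := by
  induction L generalizing A with
  | nil => exact hA
  | cons x L ih => exact ih (hA.cone x)

lemma coneL_append (L L' : List R) (A : DiffModule R) :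
    A.coneL (L ++ L') = (A.coneL L).coneL L' := by
  induction L generalizing A with
  | nil => rfl
  | cons x L ih => exact ih _

lemma bijective_smul_cone {A : DiffModule R} {x : R} (y : R)
    (hx : Function.Bijective fun a : A => x • a) :
    Function.Bijective fun a : A.cone y => x • a := by
  have h1 : Function.Injective (LinearMap.lsmul R A x) := hx.1
  have h2 : Function.Surjective (LinearMap.lsmul R A x) := hx.2
  have e (u : Loc y A) : locMap y (LinearMap.lsmul R A x) u = x • u := by
    obtain ⟨m, k, rfl⟩ := exists_frac u
    rw [locMap_frac, smul_frac]
    rfl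
  have i : Function.Injective (locMap y (LinearMap.lsmul R A x)) :=
    IsLocalizedModule.map_injective _ _ _ _ h1
  have s : Function.Surjective (locMap y (LinearMap.lsmul R A x)) :=
    IsLocalizedModule.map_surjective _ _ _ _ h2
  rw [show ⇑(locMap y (LinearMap.lsmul R A x)) = fun u => x • u from funext e] at i s
  exact hx.prodMap ⟨i, s⟩

lemma isAcyclic_coneL_of_bijective {L : List R} {A : DiffModule R} {x : R} (hL : x ∈ L)
    (hx : Function.Bijective fun a : A => x • a) : (A.coneL L).IsAcyclic := by
  induction L generalizing A with
  | nil => simp at hL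
  | cons y L ih =>
    obtain rfl | h := List.mem_cons.1 hL
    · exact (isAcyclic_cone_of_bijective hx).coneL L
    · exact ih h (bijective_smul_cone y hx)

end DiffModule

end Cone

section Single

variable {R}

namespace DiffModule

namespace Hom

variable {A B C : DiffModule R}

/-- The identity. -/
def id (A : DiffModule R) : Hom A A where
  f := LinearMap.id
  f_d _ := rfl
  f_p _ _ := rfl

/-- Composition of morphisms of complexes. -/
def comp (g : Hom B C) (f : Hom A B) : Hom A C where
  f := g.f.comp f.f
  f_d x := (congrArg g.f (f.f_d x)).trans (g.f_d _)
  f_p n x := (congrArg g.f (f.f_p n x)).trans (g.f_p n _)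

lemma map_id (n : ℤ) : (id A).map n = LinearMap.id := by
  ext z
  rfl

lemma map_comp (g : Hom B C) (f : Hom A B) (n : ℤ) :
    (g.comp f).map n = (g.map n).comp (f.map n) := by
  ext z
  rfl

lemma cone_id (x : R) : (id A).cone x = id (A.cone x) :=
  Hom.ext (LinearMap.ext fun ⟨_, u⟩ => Prod.ext rfl (locMap_id x u))

lemma cone_comp (x : R) (g : Hom B C) (f : Hom A B) :
    (g.comp f).cone x = (g.cone x).comp (f.cone x) := by
  refine Hom.ext (LinearMap.ext fun ⟨a, u⟩ => Prod.ext rfl ?_)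
  change locMap x (g.f.comp f.f) u = locMap x g.f (locMap x f.f u)
  obtain ⟨m, k, rfl⟩ := exists_frac u
  simp

lemma coneL_id (L : List R) : (id A).coneL L = id (A.coneL L) := by
  induction L generalizing A with
  | nil => rfl
  | cons x L ih =>
    change ((id A).cone x).coneL L = _
    rw [cone_id]
    exact ih

lemma coneL_comp (L : List R) (g : Hom B C) (f : Hom A B) :
    (g.comp f).coneL L = (g.coneL L).comp (f.coneL L) := by
  induction L generalizing A B C with
  | nil => rfl
  | cons x L ih =>
    change ((g.comp f).cone x).coneL L = _
    rw [cone_comp]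
    exact ih _ _

/-- The cokernel of a morphism of complexes. -/
def coker (f : Hom A B) : DiffModule R where
  carrier := B ⧸ LinearMap.range f.f
  d := Submodule.mapQ _ _ B.d (by
    rintro _ ⟨a, rfl⟩
    exact ⟨A.d a, f.f_d a⟩)
  p n := Submodule.mapQ _ _ (B.p n) (by
    rintro _ ⟨a, rfl⟩
    exact ⟨A.p n a, f.f_p n a⟩)
  d_d x := by
    obtain ⟨b, rfl⟩ := Submodule.mkQ_surjective _ x
    exact (congrArg (Submodule.mkQ _) (B.d_d b)).trans (map_zero _)
  d_p n x := by
    obtain ⟨b, rfl⟩ := Submodule.mkQ_surjective _ x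
    exact congrArg (Submodule.mkQ _) (B.d_p n b)
  p_p_self n x := by
    obtain ⟨b, rfl⟩ := Submodule.mkQ_surjective _ x
    exact congrArg (Submodule.mkQ _) (B.p_p_self n b)
  p_p_ne n m x h := by
    obtain ⟨b, rfl⟩ := Submodule.mkQ_surjective _ x
    exact (congrArg (Submodule.mkQ _) (B.p_p_ne n m b h)).trans (map_zero _)
  sum_p := by
    obtain ⟨S, hS⟩ := B.sum_p
    refine ⟨S, fun x => ?_⟩
    obtain ⟨b, rfl⟩ := Submodule.mkQ_surjective _ x
    conv_rhs => rw [← hS b, map_sum]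
    rfl

/-- The projection to the cokernel. -/
def toCoker (f : Hom A B) : Hom B f.coker where
  f := Submodule.mkQ _
  f_d _ := rfl
  f_p _ _ := rfl

lemma shortExact_toCoker (f : Hom A B) (hf : Function.Injective f.f) :
    ShortExact f f.toCoker where
  inj := hf
  exact := LinearMap.exact_iff.2 (Submodule.ker_mkQ _)
  surj := Submodule.mkQ_surjective _

/-- An injective quasi-isomorphism induces isomorphisms on the cohomology of iterated cones. -/
lemma bijective_map_coneL (f : Hom A B) (hf : Function.Injective f.f)
    (h : ∀ b a, B.d b = f.f a → ∃ c a', b = B.d c + f.f a') (L : List R) (n : ℤ) :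
    Function.Bijective ((f.coneL L).map n) := by
  refine ((f.shortExact_toCoker hf).coneL L).bijective_of_acyclic_right ?_ n
  refine IsAcyclic.coneL L fun z hz => ?_
  obtain ⟨b, rfl⟩ := Submodule.mkQ_surjective _ z
  obtain ⟨a, ha⟩ := (Submodule.Quotient.mk_eq_zero _).1 hz
  obtain ⟨c, a', rfl⟩ := h b a ha.symm
  refine ⟨Submodule.mkQ _ c, ?_⟩
  rw [map_add]
  exact (add_eq_left.2 ((Submodule.Quotient.mk_eq_zero (LinearMap.range f.f)).2
    (LinearMap.mem_range.2 ⟨a', rfl⟩))).symm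

end Hom

lemma ShortExact.exists_connecting' {A B C : DiffModule R} {f : Hom A B} {g : Hom B C}
    (h : ShortExact f g) {n m : ℤ} (hnm : n + 1 = m) :
    ∃ δ : C.H n →ₗ[R] A.H m,
      Function.Exact (g.map n) δ ∧ Function.Exact δ (f.map m) := by
  subst hnm
  exact h.exists_connecting n

/-- The complex given by a module placed in degree `a`. -/
def single (a : ℤ) (N : Type u) [AddCommGroup N] [Module R N] : DiffModule R where
  carrier := N
  d := 0
  p n := if n = a then LinearMap.id else 0
  d_d _ := rfl
  d_p _ _ := by simp
  p_p_self n x := by split <;> rfl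
  p_p_ne n m x h := by
    by_cases hn : n = a <;> by_cases hm : m = a
    · exact absurd (hn.trans hm.symm) h
    all_goals simp [hn, hm]
  sum_p := ⟨{a}, fun x => by simp⟩

section

variable {N N' : Type u} [AddCommGroup N] [Module R N] [AddCommGroup N'] [Module R N']

lemma single_p_self (a : ℤ) (x : N) : (single (R := R) a N).p a x = x := by
  change (if a = a then LinearMap.id else 0 : N →ₗ[R] N) x = x
  rw [if_pos rfl]
  rfl

lemma single_p_ne {a n : ℤ} (h : n ≠ a) (x : N) : (single (R := R) a N).p n x = 0 := by
  change (if n = a then LinearMap.id else 0 : N →ₗ[R] N) x = 0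
  rw [if_neg h]
  rfl

/-- Functoriality of `single`. -/
def singleHom (a : ℤ) (f : N →ₗ[R] N') :
    Hom (single (R := R) a N) (single (R := R) a N') where
  f := f
  f_d _ := map_zero f
  f_p n x := by
    by_cases h : n = a
    · subst h
      exact (congrArg f (single_p_self (R := R) n x)).trans (single_p_self (R := R) n (f x)).symm
    · exact ((congrArg f (single_p_ne (R := R) h x)).trans (map_zero f)).trans
        (single_p_ne (R := R) h (f x)).symm

end

lemma subsingleton_H {A : DiffModule R} {n : ℤ} (h : ∀ x, A.p n x = 0) : Subsingleton (A.H n) := by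
  have (a : A.H n) : a = 0 := by
    obtain ⟨z, rfl⟩ := A.cls_surjective n a
    have : z = 0 := Subtype.ext ((mem_Z.1 z.2).2.symm.trans (h _))
    rw [this, map_zero]
  exact ⟨fun a b => (this a).trans (this b).symm⟩

/-- `A` is concentrated in degrees at least `a`. -/
def IsGE (A : DiffModule R) (a : ℤ) : Prop := ∀ n < a, ∀ x, A.p n x = 0

lemma IsGE.cone {A : DiffModule R} {a : ℤ} (h : A.IsGE a) (x : R) : (A.cone x).IsGE a := by
  rintro n hn ⟨b, u⟩
  obtain ⟨m, k, rfl⟩ := exists_frac u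
  rw [cone_p, locMap_frac, h n hn, h _ (by omega), frac_zero]
  rfl

lemma IsGE.coneL {A : DiffModule R} {a : ℤ} (h : A.IsGE a) (L : List R) : (A.coneL L).IsGE a := by
  induction L generalizing A with
  | nil => exact h
  | cons x L ih => exact ih (h.cone x)

lemma isGE_single (a : ℤ) (N : Type u) [AddCommGroup N] [Module R N] :
    (single (R := R) a N).IsGE a := fun _ hn x => single_p_ne hn.ne x

lemma IsGE.cls_injective {A : DiffModule R} {a : ℤ} (h : A.IsGE a) :
    Function.Injective (A.cls a) := by
  rw [injective_iff_map_eq_zero]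
  intro z hz
  obtain ⟨y, hy, hyp⟩ := exists_d_eq (n := a - 1)
    (by rw [sub_add_cancel]; exact (mem_Z.1 z.2).2) (cls_eq_zero.1 hz)
  rw [h _ (by omega)] at hyp
  rw [← hyp, map_zero] at hy
  exact Subtype.ext hy.symm

/-- The projection of the iterated cone to the original complex. -/
def coneLFst : (L : List R) → (A : DiffModule R) → Hom (A.coneL L) A
  | [], A => Hom.id A
  | x :: L, A => (coneFst x A).comp (coneLFst L (A.cone x))

lemma coneLFst_comp (L : List R) {A B : DiffModule R} (f : Hom A B) :
    (coneLFst L B).comp (f.coneL L) = f.comp (coneLFst L A) := by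
  induction L generalizing A B with
  | nil => rfl
  | cons x L ih => exact congrArg (Hom.comp (coneFst x B)) (ih (f.cone x))

lemma IsGE.mem_Z_cone {A : DiffModule R} {a : ℤ} (h : A.IsGE a) {x : R} {z : A.cone x} :
    z ∈ (A.cone x).Z a ↔ z.1 ∈ A.Z a ∧ z.2 = 0 ∧ ∃ t, x ^ t • z.1 = 0 := by
  obtain ⟨c, u⟩ := z
  have hu : locMap x (A.p (a - 1)) u = 0 := by
    obtain ⟨m, k, rfl⟩ := exists_frac u
    rw [locMap_frac, h _ (by omega), frac_zero]
  have e : (c, u) ∈ (A.cone x).Z a ↔ (A.d c = 0 ∧ toLoc x A c - locMap x A.d u = 0) ∧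
      A.p a c = c ∧ locMap x (A.p (a - 1)) u = u := by
    refine and_congr ?_ ?_
    · exact Prod.mk_eq_zero
    · exact Prod.mk.injEq .. |>.to_iff
  refine e.trans ?_
  rw [hu]
  change _ ↔ (A.d c = 0 ∧ A.p a c = c) ∧ u = 0 ∧ ∃ t, x ^ t • c = 0
  constructor
  · rintro ⟨⟨h1, h2⟩, h3, rfl⟩
    rw [map_zero, sub_zero, toLoc_apply, frac_eq_zero] at h2
    exact ⟨⟨h1, h3⟩, rfl, h2⟩
  · rintro ⟨⟨h1, h3⟩, h4, h2⟩
    obtain rfl : u = 0 := h4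
    refine ⟨⟨h1, ?_⟩, h3, rfl⟩
    rw [map_zero, sub_zero, toLoc_apply, frac_eq_zero]
    exact h2

lemma IsGE.coneLFst_injective {A : DiffModule R} {a : ℤ} (h : A.IsGE a) (L : List R) :
    Function.Injective ((coneLFst L A).map a) := by
  induction L generalizing A with
  | nil =>
    change Function.Injective ((Hom.id A).map a)
    rw [Hom.map_id]
    exact Function.injective_id
  | cons x L ih =>
    change Function.Injective (((coneFst x A).comp (coneLFst L (A.cone x))).map a)
    rw [Hom.map_comp]
    refine Function.Injective.comp (g := (coneFst x A).map a)
      (f := (coneLFst L (A.cone x)).map a) ?_ (ih (h.cone x))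
    rw [injective_iff_map_eq_zero]
    intro c hc
    obtain ⟨z, rfl⟩ := (A.cone x).cls_surjective a c
    have h0 := (h.mem_Z_cone).1 z.2
    have h1 : (coneFst x A).mapZ a z = 0 := h.cls_injective (hc.trans (map_zero _).symm)
    have h2 : z = 0 := Subtype.ext (Prod.ext (congrArg Subtype.val h1) h0.2.1)
    rw [h2, map_zero]

lemma IsGE.exists_coneLFst_iff {A : DiffModule R} {a : ℤ} (h : A.IsGE a) (L : List R) (z : A.Z a) :
    (∃ w, (coneLFst L A).map a w = A.cls a z) ↔ ∀ x ∈ L, ∃ t, x ^ t • z = 0 := by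
  induction L generalizing A with
  | nil =>
    simp only [List.not_mem_nil, false_imp_iff, implies_true, iff_true]
    exact ⟨A.cls a z, rfl⟩
  | cons x L ih =>
    have e : ∀ w, (coneLFst (x :: L) A).map a w =
      (coneFst x A).map a ((coneLFst L (A.cone x)).map a w) := LinearMap.congr_fun
        (Hom.map_comp (coneFst x A) (coneLFst L (A.cone x)) a)
    simp only [List.mem_cons, forall_eq_or_imp]
    constructor
    · rintro ⟨w, hw⟩
      replace hw := (e w).symm.trans hw
      obtain ⟨z', hz'⟩ := (A.cone x).cls_surjective a ((coneLFst L (A.cone x)).map a w)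
      have h3 := (ih (h.cone x) z').1 ⟨w, hz'.symm⟩
      rw [← hz'] at hw
      have h4 : (coneFst x A).mapZ a z' = z := h.cls_injective hw
      have h5 : z'.1.1 = z.1 := congrArg Subtype.val h4
      have h0 := (h.mem_Z_cone).1 z'.2
      refine ⟨?_, fun y hy => ?_⟩
      · obtain ⟨t, ht⟩ := h0.2.2
        exact ⟨t, Subtype.ext (by rw [h5] at ht; exact ht)⟩
      · obtain ⟨t, ht⟩ := h3 y hy
        refine ⟨t, ?_⟩
        rw [← h4, ← map_smul, ht, map_zero]
    · rintro ⟨⟨t, ht⟩, h2⟩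
      let z' : (A.cone x).Z a := ⟨(z.1, 0), h.mem_Z_cone.2 ⟨z.2, rfl, t, congrArg Subtype.val ht⟩⟩
      obtain ⟨w, hw⟩ := (ih (h.cone x) z').2 fun y hy => by
        obtain ⟨t, ht⟩ := h2 y hy
        exact ⟨t, Subtype.ext (Prod.ext (congrArg Subtype.val ht) (smul_zero _))⟩
      exact ⟨w, (e w).trans (congrArg ((coneFst x A).map a) hw)⟩

end DiffModule

end Single

section Injectives

variable {R}

lemma exists_extend {N N' J : Type u} [AddCommGroup N] [Module R N] [AddCommGroup N'] [Module R N']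
    [AddCommGroup J] [Module R J] [Module.Injective R J] (i : N →ₗ[R] N')
    (hi : Function.Injective i) (g : N →ₗ[R] J) : ∃ h : N' →ₗ[R] J, ∀ x, h (i x) = g x :=
  Module.Injective.out i hi g

variable {J : Type u} [AddCommGroup J] [Module R J]

lemma exists_smul_eq_of_injective [Module.Injective R J] (y : R) (w : J)
    (h : ∀ r : R, r * y = 0 → r • w = 0) : ∃ b : J, y • b = w := by
  let e : R →ₗ[R] R := LinearMap.toSpanSingleton R R y
  let i : (R ⧸ LinearMap.ker e) →ₗ[R] R := (LinearMap.ker e).liftQ e le_rfl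
  have hi : Function.Injective i := LinearMap.ker_eq_bot.1 (Submodule.ker_liftQ_eq_bot' _ _ rfl)
  let g : (R ⧸ LinearMap.ker e) →ₗ[R] J := (LinearMap.ker e).liftQ (LinearMap.toSpanSingleton R J w)
    fun r hr => h r hr
  obtain ⟨k, hk⟩ := exists_extend i hi g
  refine ⟨k 1, ?_⟩
  have h1 := hk (Submodule.mkQ _ 1)
  have h2 : i (Submodule.mkQ _ 1) = y := one_smul R y
  have h3 : g (Submodule.mkQ _ 1) = w := one_smul R w
  rw [h2, h3] at h1
  rw [← h1, ← map_smul, smul_eq_mul, mul_one]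

lemma exists_pow_smul_eq_zero_of_finite {N : Type u} [AddCommGroup N] [Module R N]
    [Module.Finite R N] (x : R) (g : N →ₗ[R] J) (h : ∀ r, ∃ l, x ^ l • g r = 0) :
    ∃ k, ∀ r, x ^ k • g r = 0 := by
  classical
  obtain ⟨S, hS⟩ := (Module.Finite.fg_top : (⊤ : Submodule R N).FG)
  choose l hl using h
  refine ⟨∑ r ∈ S, l r, fun r => ?_⟩
  have : (⊤ : Submodule R N) ≤ LinearMap.ker ((LinearMap.lsmul R J (x ^ ∑ r ∈ S, l r)).comp g) := by
    rw [← hS, Submodule.span_le]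
    intro r hr
    change x ^ _ • g r = 0
    rw [← Finset.sum_erase_add _ _ hr, pow_add, mul_smul, hl, smul_zero]
  exact this (Submodule.mem_top (x := r))

variable [IsNoetherianRing R]

lemma toLoc_surjective_of_injective [Module.Injective R J] (x : R) :
    Function.Surjective (toLoc x J) := by
  intro v
  obtain ⟨m, k, rfl⟩ := exists_frac v
  let f : ℕ →o Ideal R :=
    ⟨fun l => LinearMap.ker (LinearMap.toSpanSingleton R R (x ^ l)), fun l l' h r hr => by
      change r * x ^ l = 0 at hr
      change r * x ^ l' = 0
      rw [← Nat.add_sub_cancel' h, pow_add, ← mul_assoc, hr, zero_mul]⟩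
  obtain ⟨l, hl⟩ := monotone_stabilizes_iff_noetherian.2 ‹IsNoetherianRing R› f
  obtain ⟨b, hb⟩ := exists_smul_eq_of_injective (x ^ (l + k)) (x ^ l • m) fun r hr => by
    have h1 : r ∈ f (l + k) := hr
    rw [← hl (l + k) (by omega)] at h1
    rw [smul_smul, show r * x ^ l = 0 from h1, zero_smul]
  refine ⟨b, ?_⟩
  rw [toLoc_apply, frac_eq_frac]
  exact ⟨l, by rw [hb, add_zero]⟩

/-- The `x`-power torsion of an injective module is injective. -/
lemma injective_ker_toLoc [Module.Injective R J] (x : R) :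
    Module.Injective R (LinearMap.ker (toLoc x J)) := by
  have mem (y : J) : y ∈ LinearMap.ker (toLoc x J) ↔ ∃ l, x ^ l • y = 0 := by
    rw [LinearMap.mem_ker, toLoc_apply, frac_eq_zero]
  refine Module.Baer.injective fun A g => ?_
  obtain ⟨k, hk⟩ := exists_pow_smul_eq_zero_of_finite x g fun r => by
    obtain ⟨l, hl⟩ := (mem _).1 (g r).2
    exact ⟨l, Subtype.ext hl⟩
  obtain ⟨c, hc⟩ := Ideal.exists_pow_inf_eq_pow_smul (Ideal.span {x}) A
  have hN := hc (k + c) (by omega)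
  rw [Nat.add_sub_cancel] at hN
  let I : Ideal R := Ideal.span {x ^ (k + c)}
  have hI : I = Ideal.span {x} ^ (k + c) • (⊤ : Ideal R) := by
    rw [Ideal.span_singleton_pow, smul_eq_mul, Ideal.mul_top]
  rw [← hI] at hN
  have hker : LinearMap.ker (I.mkQ.comp A.subtype) ≤ LinearMap.ker g := by
    intro r hr
    have h1 : (r : R) ∈ I ⊓ A := ⟨(Submodule.Quotient.mk_eq_zero I).1 hr, r.2⟩
    rw [hN, Ideal.span_singleton_pow, smul_eq_mul, Ideal.mem_span_singleton_mul] at h1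
    obtain ⟨z, hz, hzr⟩ := h1
    have : r = x ^ k • ⟨z, hz.2⟩ := Subtype.ext hzr.symm
    rw [LinearMap.mem_ker, this, map_smul, hk]
  let i : (A ⧸ LinearMap.ker (I.mkQ.comp A.subtype)) →ₗ[R] (R ⧸ I) :=
    Submodule.liftQ _ (I.mkQ.comp A.subtype) le_rfl
  have hi : Function.Injective i := LinearMap.ker_eq_bot.1 (Submodule.ker_liftQ_eq_bot' _ _ rfl)
  obtain ⟨h, hh⟩ := exists_extend i hi ((Submodule.subtype _).comp
    (Submodule.liftQ _ g hker))
  refine ⟨(h.comp I.mkQ).codRestrict _ fun r => (mem _).2 ⟨k + c, ?_⟩, fun r hr => ?_⟩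
  · rw [← map_smul]
    refine (congrArg h ((Submodule.Quotient.mk_eq_zero I).2 ?_)).trans (map_zero h)
    exact Ideal.mul_mem_right _ _ (Ideal.mem_span_singleton_self _)
  · exact Subtype.ext (hh (Submodule.mkQ _ ⟨r, hr⟩))

end Injectives

section ConeCohomology

variable {R}

namespace DiffModule

lemma subsingleton_H_coneL_single [IsNoetherianRing R] (L : List R) (J : Type u) [AddCommGroup J]
    [Module R J] [Module.Injective R J] {a n : ℤ} (hn : n ≠ a) :
    Subsingleton (((single a J).coneL L).H n) := by
  induction L generalizing J with
  | nil => exact subsingleton_H (A := single (R := R) a J) fun x => single_p_ne (R := R) (N := J) hn x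
  | cons x L ih =>
    have := injective_ker_toLoc (J := J) x
    have hs := toLoc_surjective_of_injective (J := J) x
    have hd (b : J) (u : Loc x J) : ((single (R := R) a J).cone x).d (b, u) =
        ((0, toLoc x J b) : J × Loc x J) := by
      refine Prod.ext rfl ?_
      change toLoc x J b - locMap x (0 : J →ₗ[R] J) u = toLoc x J b
      rw [map_zero, LinearMap.zero_apply, sub_zero]
    let i : LinearMap.ker (toLoc x J) →ₗ[R] J := Submodule.subtype _
    let f : Hom (single a (LinearMap.ker (toLoc x J))) ((single a J).cone x) :=
      { f := (LinearMap.inl R J (Loc x J)).comp i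
        f_d := fun y => (map_zero ((LinearMap.inl R J (Loc x J)).comp i)).trans
          ((hd y.1 0).trans (congrArg (Prod.mk (0 : J)) (LinearMap.mem_ker.1 y.2))).symm
        f_p := fun n y => by
          have h := (singleHom a i).f_p n y
          exact Prod.ext h (map_zero (locMap x ((single (R := R) a J).p (n - 1)))).symm }
    have hf : Function.Injective f.f := fun y y' h => Subtype.ext (congrArg Prod.fst h)
    have hb := f.bijective_map_coneL hf (by
      rintro ⟨b, u⟩ c h
      obtain ⟨v, rfl⟩ := hs u
      have h0 : toLoc x J b = 0 := congrArg Prod.snd ((hd b _).symm.trans h)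
      refine ⟨((v, 0) : J × Loc x J), ⟨b, h0⟩, ?_⟩
      refine Eq.trans ?_ (congrArg (· + f.f ⟨b, h0⟩) (hd v 0)).symm
      exact Prod.ext (zero_add b).symm (add_zero _).symm) L n
    have := ih (LinearMap.ker (toLoc x J))
    exact hb.2.subsingleton

/-- The cohomology of iterated cones, as functors. -/
def coneFunctor (L : List R) (a n : ℤ) : ModuleCat.{u} R ⥤ ModuleCat.{u} R where
  obj N := ModuleCat.of R (((single a N).coneL L).H n)
  map {N N'} f := ModuleCat.ofHom (((singleHom a f.hom).coneL L).map n)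
  map_id N := by
    refine ModuleCat.hom_ext ?_
    refine (congrArg (fun g => Hom.map g n) (Hom.coneL_id L (A := single a N))).trans ?_
    exact Hom.map_id n
  map_comp {N N' N''} f g := by
    refine ModuleCat.hom_ext ?_
    refine (congrArg (fun g => Hom.map g n) (Hom.coneL_comp L (singleHom a g.hom)
      (singleHom a f.hom))).trans ?_
    exact Hom.map_comp _ _ n

/-- The cohomology of `single a N` in degree `a` is `N`. -/
def singleHSelf (a : ℤ) (N : Type u) [AddCommGroup N] [Module R N] :
    (single (R := R) a N).H a →ₗ[R] N :=
  Submodule.liftQ _ ((single (R := R) a N).Z a).subtype (by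
    rintro z ⟨y, hy⟩
    exact hy.symm)

lemma singleHSelf_bijective (a : ℤ) (N : Type u) [AddCommGroup N] [Module R N] :
    Function.Bijective (singleHSelf (R := R) a N) := by
  constructor
  · rw [injective_iff_map_eq_zero]
    intro c hc
    obtain ⟨z, rfl⟩ := cls_surjective _ a c
    have : z = 0 := Subtype.ext hc
    rw [this, map_zero]
  · intro y
    exact ⟨(single a N).cls a ⟨y, rfl, single_p_self a y⟩, rfl⟩

lemma singleHSelf_naturality (a : ℤ) {N N' : Type u} [AddCommGroup N] [Module R N]
    [AddCommGroup N'] [Module R N'] (f : N →ₗ[R] N') (c : (single (R := R) a N).H a) :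
    singleHSelf a N' ((singleHom a f).map a c) = f (singleHSelf a N c) := by
  obtain ⟨z, rfl⟩ := cls_surjective _ a c
  rfl

lemma forall_pow_smul_iff [IsNoetherianRing R] (L : List R) {N : Type u} [AddCommGroup N]
    [Module R N] (y : N) : (∀ x ∈ L, ∃ t, x ^ t • y = 0) ↔
      ∃ t : ℕ, ∀ r ∈ Ideal.span {x : R | x ∈ L} ^ t, r • y = 0 := by
  constructor
  · intro h
    have h1 : Ideal.span {x : R | x ∈ L} ≤ Ideal.radical (LinearMap.ker (LinearMap.toSpanSingleton R N y)) := by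
      rw [Ideal.span_le]
      exact fun x hx => h x hx
    obtain ⟨t, ht⟩ := Ideal.exists_pow_le_of_le_radical_of_fg h1
      (isNoetherian_def.1 ‹IsNoetherianRing R› _)
    exact ⟨t, fun r hr => ht hr⟩
  · rintro ⟨t, ht⟩ x hx
    exact ⟨t, ht _ (Ideal.pow_mem_pow (Ideal.subset_span (show x ∈ {x : R | x ∈ L} from hx)) t)⟩

lemma isTorsionCohomology_coneFunctor [IsNoetherianRing R] (L : List R) (a : ℤ) :
    IsTorsionCohomology (Ideal.span {x : R | x ∈ L}) fun n : ℕ => coneFunctor L a (a + n) where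
  zero := by
    let ε : coneFunctor L a a ⟶ 𝟭 (ModuleCat.{u} R) :=
      { app := fun N => ModuleCat.ofHom
          ((singleHSelf a N).comp ((coneLFst L (single (R := R) a N)).map a))
        naturality := fun N N' f => by
          refine ModuleCat.hom_ext (LinearMap.ext fun c => ?_)
          have h := congrArg (fun g => Hom.map g a) (coneLFst_comp L (singleHom a f.hom))
          have h' := (Hom.map_comp (coneLFst L (single a N')) ((singleHom a f.hom).coneL L) a).symm.trans
            (h.trans (Hom.map_comp (singleHom a f.hom) (coneLFst L (single a N)) a))
          refine Eq.trans ?_ (singleHSelf_naturality a f.hom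
            ((coneLFst L (single (R := R) a N)).map a c))
          exact congrArg (singleHSelf a N') (LinearMap.congr_fun h' c) }
    have h (N : ModuleCat.{u} R) : Function.Injective (ε.app N) ∧ ∀ x : N,
        (∃ y, ε.app N y = x) ↔ ∃ t : ℕ, ∀ r ∈ Ideal.span {x : R | x ∈ L} ^ t, r • x = 0 := by
      have hge := isGE_single (R := R) a N
      refine ⟨(singleHSelf_bijective a N).1.comp (hge.coneLFst_injective L), fun x => ?_⟩
      rw [← forall_pow_smul_iff]
      let z : (single (R := R) a N).Z a := ⟨x, rfl, single_p_self a x⟩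
      have h1 := hge.exists_coneLFst_iff L z
      have h2 : (∀ x ∈ L, ∃ t, x ^ t • z = 0) ↔ ∀ y ∈ L, ∃ t, y ^ t • x = 0 :=
        forall₂_congr fun y _ => exists_congr fun t => Subtype.ext_iff
      rw [← h2, ← h1]
      refine exists_congr fun w => ?_
      constructor
      · intro hw
        exact (singleHSelf_bijective a N).1 hw
      · intro hw
        exact congrArg (singleHSelf a N) hw
    have e : a + ((0 : ℕ) : ℤ) = a := by simp
    change ∃ ε : coneFunctor L a (a + ((0 : ℕ) : ℤ)) ⟶ 𝟭 _, _
    rw [e]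
    exact ⟨ε, h⟩
  connecting S hS hJ n := by
    have : Module.Injective R S.X₂ := Module.injective_module_of_injective_object R S.X₂
    have hse : ShortExact (singleHom a S.f.hom) (singleHom a S.g.hom) :=
      { inj := (ModuleCat.mono_iff_injective S.f).1 hS.mono_f
        exact := (ShortComplex.ShortExact.moduleCat_exact_iff_function_exact S).1 hS.exact
        surj := (ModuleCat.epi_iff_surjective S.g).1 hS.epi_g }
    obtain ⟨δ, h1, h2⟩ := (hse.coneL L).exists_connecting'
      (n := a + n) (m := a + (n + 1 : ℕ)) (by push_cast; ring)
    have := subsingleton_H_coneL_single L S.X₂ (a := a) (n := a + (n + 1 : ℕ))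
      (by push_cast; omega)
    refine ⟨ModuleCat.ofHom δ, h1, fun c => (h2 c).1 (Subsingleton.elim _ _)⟩
  vanishing n J hJ := by
    have : Module.Injective R J := Module.injective_module_of_injective_object R J
    have := subsingleton_H_coneL_single L J (a := a) (n := a + (n + 1 : ℕ))
      (by push_cast; omega)
    exact ModuleCat.isZero_iff_subsingleton.2 this

/-- Local cohomology computed by iterated cones. -/
theorem nonempty_LC_equiv [IsNoetherianRing R] (L : List R) (a i n : ℤ) (hn : a + i = n)
    (N : Type u) [AddCommGroup N] [Module R N] :
    Nonempty (LC R (Ideal.span {x : R | x ∈ L}) i N ≃ₗ[R] ((single a N).coneL L).H n) := by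
  subst hn
  by_cases hi : 0 ≤ i
  · obtain ⟨k, rfl⟩ := Int.eq_ofNat_of_zero_le hi
    rw [LC, if_pos hi]
    exact IsTorsionCohomology.nonempty_linearEquiv (isTorsionCohomology_localCohomology _)
      (isTorsionCohomology_coneFunctor L a) k (ModuleCat.of R N)
  · rw [LC, if_neg hi]
    have := subsingleton_H (((isGE_single (R := R) a N).coneL L) (a + i) (by omega))
    exact ⟨{ (0 : PUnit.{u + 1} →ₗ[R] ((single a N).coneL L).H (a + i)) with
      invFun := fun _ => PUnit.unit
      left_inv := fun _ => rfl
      right_inv := fun _ => Subsingleton.elim _ _ }⟩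

end DiffModule

end ConeCohomology

section Gradings

/-- The inclusion of the degrees of the algebra in the degrees of the modules. -/
def emb (a : ℕ × ℕ) : ℤ × ℤ := ((a.1 : ℤ), (a.2 : ℤ))

lemma emb_zero : emb 0 = 0 := rfl

lemma emb_nsmul (k : ℕ) (a : ℕ × ℕ) : emb (k • a) = k • emb a := by simp [emb]

/-- A bigrading, presented by the projections to the homogeneous components. -/
structure Gr (N : Type u) [AddCommGroup N] [Module R N] : Type u where
  π : ℤ × ℤ → N →+ N
  π_self : ∀ a x, π a (π a x) = π a x
  π_ne : ∀ a b x, a ≠ b → π a (π b x) = 0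
  sum_π : ∀ x, ∃ S : Finset (ℤ × ℤ), ∑ b ∈ S, π b x = x
  π_smul : ∀ (a : ℕ × ℕ) (r : R), r ∈ 𝒜 a → ∀ b x, π (emb a + b) (r • x) = r • π b x

variable {K R 𝒜}

namespace Gr

variable {N : Type u} [AddCommGroup N] [Module R N]

lemma eq_of_forall_π (g : Gr K R 𝒜 N) {x : N} (h : ∀ b, g.π b x = 0) : x = 0 := by
  obtain ⟨S, hS⟩ := g.sum_π x
  rw [← hS]
  exact Finset.sum_eq_zero fun b _ => h b

lemma ext_π (g : Gr K R 𝒜 N) {x y : N} (h : ∀ b, g.π b x = g.π b y) : x = y :=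
  sub_eq_zero.1 (g.eq_of_forall_π fun b => by rw [map_sub, h, sub_self])

lemma π_sum (g : Gr K R 𝒜 N) (S : Finset (ℤ × ℤ)) (x : N) (a : ℤ × ℤ) (ha : a ∈ S) :
    g.π a (∑ b ∈ S, g.π b x) = g.π a x := by
  rw [map_sum, Finset.sum_eq_single a (fun b _ hb => g.π_ne _ _ _ hb.symm) (absurd ha), g.π_self]

lemma sum_π_of_forall (g : Gr K R 𝒜 N) {S : Finset (ℤ × ℤ)} {x : N} (h : ∀ b ∉ S, g.π b x = 0) :
    ∑ b ∈ S, g.π b x = x := by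
  refine g.ext_π fun a => ?_
  by_cases ha : a ∈ S
  · exact g.π_sum S x a ha
  · rw [h a ha, map_sum]
    exact Finset.sum_eq_zero fun b hb => g.π_ne _ _ _ fun e => ha (e ▸ hb)

lemma exists_support (g : Gr K R 𝒜 N) (x : N) : ∃ S : Finset (ℤ × ℤ), ∀ b ∉ S, g.π b x = 0 := by
  obtain ⟨S, hS⟩ := g.sum_π x
  refine ⟨S, fun b hb => ?_⟩
  rw [← hS, map_sum]
  exact Finset.sum_eq_zero fun c hc => g.π_ne _ _ _ fun e => hb (e ▸ hc)

/-- Transport of a bigrading along an isomorphism. -/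
def congr {N' : Type u} [AddCommGroup N'] [Module R N'] (g : Gr K R 𝒜 N) (e : N' ≃ₗ[R] N) :
    Gr K R 𝒜 N' where
  π b := (e.symm : N →+ N').comp ((g.π b).comp (e : N' →+ N))
  π_self a x := by simp [g.π_self]
  π_ne a b x h := by simp [g.π_ne _ _ _ h]
  sum_π x := by
    obtain ⟨S, hS⟩ := g.sum_π (e x)
    refine ⟨S, ?_⟩
    apply e.injective
    simp [hS]
  π_smul a r hr b x := by simp [g.π_smul a r hr]

/-- The bigrading on a bigraded submodule. -/
def sub (g : Gr K R 𝒜 N) (W : Submodule R N) (hW : ∀ b, ∀ x ∈ W, g.π b x ∈ W) : Gr K R 𝒜 W where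
  π b := ((g.π b).comp (W.subtype : W →+ N)).codRestrict W fun x => hW b x x.2
  π_self a x := Subtype.ext (g.π_self a x)
  π_ne a b x h := Subtype.ext (g.π_ne a b x h)
  sum_π x := by
    obtain ⟨S, hS⟩ := g.sum_π x
    exact ⟨S, Subtype.ext ((AddSubmonoidClass.coe_finsetSum _ _).trans hS)⟩
  π_smul a r hr b x := Subtype.ext (g.π_smul a r hr b x)

/-- The bigrading on the quotient by a bigraded submodule. -/
def quot (g : Gr K R 𝒜 N) (W : Submodule R N) (hW : ∀ b, ∀ x ∈ W, g.π b x ∈ W) :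
    Gr K R 𝒜 (N ⧸ W) where
  π b := QuotientAddGroup.map W.toAddSubgroup W.toAddSubgroup (g.π b) fun x hx => hW b x hx
  π_self a x := by
    obtain ⟨y, rfl⟩ := W.mkQ_surjective x
    exact congrArg W.mkQ (g.π_self a y)
  π_ne a b x h := by
    obtain ⟨y, rfl⟩ := W.mkQ_surjective x
    exact (congrArg W.mkQ (g.π_ne a b y h)).trans (map_zero _)
  sum_π x := by
    obtain ⟨y, rfl⟩ := W.mkQ_surjective x
    obtain ⟨S, hS⟩ := g.sum_π y
    refine ⟨S, ?_⟩
    conv_rhs => rw [← hS, map_sum]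
    rfl
  π_smul a r hr b x := by
    obtain ⟨y, rfl⟩ := W.mkQ_surjective x
    exact congrArg W.mkQ (g.π_smul a r hr b y)

/-- The bigrading on a product. -/
def prod {N' : Type u} [AddCommGroup N'] [Module R N'] (g : Gr K R 𝒜 N) (g' : Gr K R 𝒜 N') :
    Gr K R 𝒜 (N × N') where
  π b := (g.π b).prodMap (g'.π b)
  π_self a x := Prod.ext (g.π_self a _) (g'.π_self a _)
  π_ne a b x h := Prod.ext (g.π_ne a b _ h) (g'.π_ne a b _ h)
  sum_π x := by
    obtain ⟨S, hS⟩ := g.exists_support x.1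
    obtain ⟨T, hT⟩ := g'.exists_support x.2
    refine ⟨S ∪ T, Prod.ext ?_ ?_⟩
    · rw [Prod.fst_sum]
      exact g.sum_π_of_forall fun b hb => hS b fun h => hb (Finset.mem_union_left _ h)
    · rw [Prod.snd_sum]
      exact g'.sum_π_of_forall fun b hb => hT b fun h => hb (Finset.mem_union_right _ h)
  π_smul a r hr b x := Prod.ext (g.π_smul a r hr b _) (g'.π_smul a r hr b _)

end Gr

section

variable [GradedAlgebra 𝒜] {N : Type u} [AddCommGroup N] [Module R N]

lemma algebraMap_mem_zero (c : K) : algebraMap K R c ∈ 𝒜 0 := by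
  rw [Algebra.algebraMap_eq_smul_one]
  exact (𝒜 0).smul_mem c SetLike.GradedOne.one_mem

namespace Gr

lemma π_ksmul (g : Gr K R 𝒜 N) (c : K) (b : ℤ × ℤ) (x : N) :
    g.π b (algebraMap K R c • x) = algebraMap K R c • g.π b x := by
  have := g.π_smul 0 _ (algebraMap_mem_zero c) b x
  rwa [emb_zero, zero_add] at this

lemma π_pow_smul (g : Gr K R 𝒜 N) {e : ℕ × ℕ} {x : R} (hx : x ∈ 𝒜 e) (k : ℕ) (b : ℤ × ℤ) (m : N) :
    g.π (b + k • emb e) (x ^ k • m) = x ^ k • g.π b m := by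
  rw [← emb_nsmul, add_comm]
  exact g.π_smul _ _ (SetLike.pow_mem_graded k hx) b m

lemma exists_loc (g : Gr K R 𝒜 N) {e : ℕ × ℕ} {x : R} (hx : x ∈ 𝒜 e) (b : ℤ × ℤ) :
    ∃ p : Loc x N →+ Loc x N, ∀ m k, p (frac x m k) = frac x (g.π (b + k • emb e) m) k := by
  choose m k hmk using exists_frac (x := x) (M := N)
  have key (m' : N) (k' : ℕ) : frac x (g.π (b + k (frac x m' k') • emb e) (m (frac x m' k')))
      (k (frac x m' k')) = frac x (g.π (b + k' • emb e) m') k' := by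
    have h := hmk (frac x m' k')
    generalize m (frac x m' k') = m₁ at h ⊢
    generalize k (frac x m' k') = k₁ at h ⊢
    obtain ⟨l, hl⟩ := frac_eq_frac.1 h.symm
    refine frac_eq_frac.2 ⟨l, ?_⟩
    rw [← g.π_pow_smul hx, ← g.π_pow_smul hx, hl]
    congr 2
    simp only [add_smul]
    abel
  refine ⟨AddMonoidHom.mk' (fun y => frac x (g.π (b + k y • emb e) (m y)) (k y)) fun y z => ?_,
    fun m' k' => key m' k'⟩
  obtain ⟨m₁, m₂, l, rfl, rfl⟩ := exists_frac₂ y z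
  rw [frac_add_frac, key, key, key, frac_add_frac, map_add]

/-- The bigrading on a localization. -/
def loc (g : Gr K R 𝒜 N) {e : ℕ × ℕ} {x : R} (hx : x ∈ 𝒜 e) : Gr K R 𝒜 (Loc x N) where
  π b := (g.exists_loc hx b).choose
  π_self a y := by
    obtain ⟨m, k, rfl⟩ := exists_frac y
    rw [(g.exists_loc hx a).choose_spec, (g.exists_loc hx a).choose_spec, g.π_self]
  π_ne a b y h := by
    obtain ⟨m, k, rfl⟩ := exists_frac y
    rw [(g.exists_loc hx b).choose_spec, (g.exists_loc hx a).choose_spec, g.π_ne, frac_zero]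
    exact fun h' => h (add_right_cancel h')
  sum_π y := by
    obtain ⟨m, k, rfl⟩ := exists_frac y
    obtain ⟨S, hS⟩ := g.exists_support m
    refine ⟨S.map (addRightEmbedding (-(k • emb e))), ?_⟩
    have := g.sum_π_of_forall hS
    conv_rhs => rw [← this]
    rw [Finset.sum_map]
    have h (T : Finset (ℤ × ℤ)) (f : ℤ × ℤ → N) :
        frac x (∑ b ∈ T, f b) k = ∑ b ∈ T, frac x (f b) k := by
      classical
      induction T using Finset.induction_on with
      | empty => simp [frac_zero]
      | insert b T hb ih => rw [Finset.sum_insert hb, Finset.sum_insert hb, ← ih, frac_add_frac]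
    rw [h]
    refine Finset.sum_congr rfl fun b _ => ?_
    rw [(g.exists_loc hx _).choose_spec]
    simp
  π_smul a r hr b y := by
    obtain ⟨m, k, rfl⟩ := exists_frac y
    rw [smul_frac, (g.exists_loc hx _).choose_spec, (g.exists_loc hx _).choose_spec, smul_frac,
      ← g.π_smul a r hr, add_assoc]

lemma loc_π_frac (g : Gr K R 𝒜 N) {e : ℕ × ℕ} {x : R} (hx : x ∈ 𝒜 e) (b : ℤ × ℤ) (m : N) (k : ℕ) :
    (g.loc hx).π b (frac x m k) = frac x (g.π (b + k • emb e) m) k :=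
  (g.exists_loc hx b).choose_spec m k

end Gr

end

end Gradings

section GradedComplexes

/-- A bigrading on a complex. -/
structure GrD {K R : Type u} [Field K] [CommRing R] [Algebra K R] (𝒜 : ℕ × ℕ → Submodule K R)
    (A : DiffModule R) : Type u extends Gr K R 𝒜 A where
  d_π : ∀ b x, A.d (π b x) = π b (A.d x)
  p_π : ∀ n b x, A.p n (π b x) = π b (A.p n x)

/-- A linear map respecting bigradings. -/
def Gr.IsHom {K R : Type u} [Field K] [CommRing R] [Algebra K R] {𝒜 : ℕ × ℕ → Submodule K R}
    {N N' : Type u} [AddCommGroup N] [Module R N] [AddCommGroup N'] [Module R N']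
    (g : Gr K R 𝒜 N) (g' : Gr K R 𝒜 N') (f : N →ₗ[R] N') : Prop :=
  ∀ b x, f (g.π b x) = g'.π b (f x)

variable {K R 𝒜}

namespace GrD

open DiffModule

/-- The bigrading on a complex with one term. -/
def single (a : ℤ) {N : Type u} [AddCommGroup N] [Module R N] (g : Gr K R 𝒜 N) :
    GrD 𝒜 (DiffModule.single (R := R) a N) where
  __ := g
  d_π b x := (map_zero (g.π b)).symm
  p_π n b x := by
    by_cases h : n = a
    · subst h
      exact (single_p_self (R := R) n (g.π b x)).trans
        (congrArg (g.π b) (single_p_self (R := R) n x)).symm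
    · exact (single_p_ne (R := R) h (g.π b x)).trans
        ((congrArg (g.π b) (single_p_ne (R := R) h x)).trans (map_zero (g.π b))).symm

variable {A : DiffModule R}

/-- The bigrading on the cohomology of a bigraded complex. -/
def H (g : GrD 𝒜 A) (n : ℤ) : Gr K R 𝒜 (A.H n) :=
  (g.toGr.sub (A.Z n) fun b x hx => by
    rw [mem_Z] at hx ⊢
    rw [g.d_π, g.p_π, hx.1, hx.2, map_zero]
    exact ⟨rfl, rfl⟩).quot _ (by
      rintro b x ⟨y, hy⟩
      refine ⟨g.π b y, ?_⟩
      rw [g.d_π, hy]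
      rfl)

lemma H_π_cls (g : GrD 𝒜 A) (n : ℤ) (b : ℤ × ℤ) (z : A.Z n) :
    ∃ z' : A.Z n, z'.1 = g.π b z ∧ (g.H n).π b (A.cls n z) = A.cls n z' :=
  ⟨_, rfl, rfl⟩

variable [GradedAlgebra 𝒜] {e : ℕ × ℕ} {x : R}

lemma locMap_π {N N' : Type u} [AddCommGroup N] [Module R N] [AddCommGroup N'] [Module R N']
    {g : Gr K R 𝒜 N} {g' : Gr K R 𝒜 N'} {f : N →ₗ[R] N'} (hf : g.IsHom g' f) (hx : x ∈ 𝒜 e) :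
    (g.loc hx).IsHom (g'.loc hx) (locMap x f) := by
  intro b y
  obtain ⟨m, k, rfl⟩ := exists_frac y
  rw [Gr.loc_π_frac, locMap_frac, locMap_frac, Gr.loc_π_frac, hf]

/-- The bigrading on the localization of a complex. -/
def loc (g : GrD 𝒜 A) (hx : x ∈ 𝒜 e) : GrD 𝒜 (A.loc x) where
  __ := g.toGr.loc hx
  d_π b y := (congrArg (- ·) (locMap_π g.d_π hx b y)).trans (map_neg ((g.toGr.loc hx).π b) _).symm
  p_π n b y := locMap_π (g.p_π (n - 1)) hx b y

lemma toLoc_π {N : Type u} [AddCommGroup N] [Module R N] (g : Gr K R 𝒜 N) (hx : x ∈ 𝒜 e) :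
    g.IsHom (g.loc hx) (toLoc x N) := by
  intro b m
  rw [toLoc_apply, toLoc_apply, Gr.loc_π_frac, zero_smul, add_zero]

/-- The bigrading on the cone. -/
def cone (g : GrD 𝒜 A) (hx : x ∈ 𝒜 e) : GrD 𝒜 (A.cone x) where
  __ := g.toGr.prod (g.toGr.loc hx)
  d_π b := by
    rintro ⟨a, u⟩
    refine Prod.ext (g.d_π b a) ?_
    refine Eq.trans ?_ (map_sub ((g.toGr.loc hx).π b) (toLoc x A a) (locMap x A.d u)).symm
    exact congrArg₂ (· - ·) (toLoc_π g.toGr hx b a) (locMap_π g.d_π hx b u)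
  p_π n b := by
    rintro ⟨a, u⟩
    exact Prod.ext (g.p_π n b a) (locMap_π (g.p_π (n - 1)) hx b u)

/-- The bigrading on the iterated cone. -/
def coneL (e : ℕ × ℕ) : (L : List R) → (∀ x ∈ L, x ∈ 𝒜 e) → {A : DiffModule R} → GrD 𝒜 A →
    GrD 𝒜 (A.coneL L)
  | [], _, _, g => g
  | x :: L, hL, _, g => coneL e L (fun y hy => hL y (List.mem_cons_of_mem _ hy))
      (g.cone (hL x List.mem_cons_self))

end GrD

/-- Components with first degree less than `B` vanish. -/
def Gr.Bounded {N : Type u} [AddCommGroup N] [Module R N] (g : Gr K R 𝒜 N) (B : ℤ) : Prop :=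
  ∀ b, b.1 < B → ∀ y, g.π b y = 0

lemma GrD.bounded_coneL [GradedAlgebra 𝒜] {B : ℤ} (L : List R) (hL : ∀ x ∈ L, x ∈ 𝒜 (0, 1))
    {A : DiffModule R} (g : GrD 𝒜 A) (h : g.toGr.Bounded B) :
    (g.coneL (0, 1) L hL).toGr.Bounded B := by
  induction L generalizing A with
  | nil => exact h
  | cons x L ih =>
    refine ih _ (g.cone (hL x List.mem_cons_self)) ?_
    rintro b hb ⟨a, u⟩
    refine Prod.ext (h b hb a) ?_
    obtain ⟨m, k, rfl⟩ := exists_frac u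
    refine (g.toGr.loc_π_frac _ b m k).trans ?_
    rw [h _ _ m, frac_zero]
    · rfl
    · simpa [emb] using hb

lemma Gr.exists_bounded [GradedAlgebra 𝒜] {N : Type u} [AddCommGroup N] [Module R N]
    [Module.Finite R N] (g : Gr K R 𝒜 N) : ∃ B, g.Bounded B := by
  classical
  obtain ⟨S, hS⟩ := (Module.Finite.fg_top : (⊤ : Submodule R N).FG)
  choose T hT using g.exists_support
  obtain ⟨B, hB⟩ : ∃ B : ℤ, ∀ b ∈ S.biUnion T, B ≤ b.1 :=
    ⟨(insert 0 ((S.biUnion T).image Prod.fst)).min' (Finset.insert_nonempty _ _), fun b hb =>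
      Finset.min'_le _ _ (Finset.mem_insert_of_mem (Finset.mem_image_of_mem _ hb))⟩
  let W : Submodule R N :=
    { carrier := {y | ∀ b, b.1 < B → g.π b y = 0}
      add_mem' := fun hy hz b hb => by rw [map_add, hy b hb, hz b hb, add_zero]
      zero_mem' := fun b hb => map_zero _
      smul_mem' := fun r y hy => by
        induction r using DirectSum.Decomposition.inductionOn 𝒜 with
        | zero => exact fun b _ => by rw [zero_smul, map_zero]
        | @homogeneous i r =>
          intro b hb
          have := g.π_smul i r r.2 (b - emb i) y
          rw [add_sub_cancel] at this
          rw [this, hy _ (by simp only [emb, Prod.fst_sub]; omega), smul_zero]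
        | add r r' h h' =>
          intro b hb
          rw [add_smul, map_add, h b hb, h' b hb, add_zero] }
  have : (⊤ : Submodule R N) ≤ W := by
    rw [← hS, Submodule.span_le]
    intro y hy b hb
    refine hT y b fun h => ?_
    have := hB b (Finset.mem_biUnion.2 ⟨y, hy, h⟩)
    omega
  exact ⟨B, fun b hb y => this (Submodule.mem_top (x := y)) b hb⟩

section Bigradings

variable [GradedAlgebra 𝒜] {N : Type u} [AddCommGroup N] [Module R N]

/-- The projections associated with a bigrading. -/
def Bigrading.toGr (bg : Bigrading K R 𝒜 N) : Gr K R 𝒜 N :=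
  letI : DirectSum.Decomposition bg.grading := bg.internal.chooseDecomposition
  { π := fun b => AddMonoidHom.mk' (fun x => (DirectSum.decompose bg.grading x b : N)) fun x y => by
      rw [DirectSum.decompose_add]
      rfl
    π_self := fun a x => DirectSum.decompose_of_mem_same _ (SetLike.coe_mem _)
    π_ne := fun a b x h => DirectSum.decompose_of_mem_ne _ (SetLike.coe_mem _) h.symm
    sum_π := fun x => by
      classical
      exact ⟨_, DirectSum.sum_support_decompose bg.grading x⟩
    π_smul := fun a r hr b x => by
      change (DirectSum.decompose bg.grading (r • x) (emb a + b) : N) =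
        r • (DirectSum.decompose bg.grading x b : N)
      induction x using DirectSum.Decomposition.inductionOn bg.grading with
      | zero => simp
      | @homogeneous i x =>
        have h : r • (x : N) ∈ bg.grading (emb a + i) := bg.compat a i r x hr x.2
        by_cases hi : i = b
        · subst hi
          rw [DirectSum.decompose_of_mem_same _ h, DirectSum.decompose_of_mem_same _ x.2]
        · rw [DirectSum.decompose_of_mem_ne _ h fun e => hi (add_left_cancel e),
            DirectSum.decompose_of_mem_ne _ x.2 hi, smul_zero]
      | add x y hx hy =>
        rw [smul_add, DirectSum.decompose_add, DirectSum.decompose_add, DirectSum.add_apply,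
          DirectSum.add_apply, AddSubgroup.coe_add, AddSubgroup.coe_add, hx, hy, smul_add] }

/-- The bigrading associated with a system of projections. -/
def Gr.toBigrading (g : Gr K R 𝒜 N) : Bigrading K R 𝒜 N where
  grading b := (g.π b).eqLocus (AddMonoidHom.id N)
  ksmul_mem c b x hx := by
    change g.π b _ = _
    rw [g.π_ksmul, show g.π b x = x from hx]
    rfl
  internal := by
    have h (v : DirectSum (ℤ × ℤ) fun b => (g.π b).eqLocus (AddMonoidHom.id N)) (a : ℤ × ℤ) :
        g.π a (DirectSum.coeAddMonoidHom _ v) = v a := by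
      induction v using DirectSum.induction_on with
      | zero => simp
      | of i x =>
        rw [DirectSum.coeAddMonoidHom_of]
        have hx : g.π i x = x := x.2
        by_cases hi : i = a
        · subst hi
          rw [DirectSum.of_eq_same, hx]
        · rw [DirectSum.of_eq_of_ne _ _ _ (Ne.symm hi), ← hx, g.π_ne _ _ _ (Ne.symm hi)]
          rfl
      | add v w hv hw => rw [map_add, map_add, hv, hw]; rfl
    constructor
    · rw [injective_iff_map_eq_zero]
      intro v hv
      refine DFinsupp.ext fun a => Subtype.ext ?_
      refine (h v a).symm.trans ?_
      rw [hv, map_zero]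
      rfl
    · intro x
      obtain ⟨S, hS⟩ := g.sum_π x
      refine ⟨∑ b ∈ S, DirectSum.of _ b ⟨g.π b x, g.π_self b x⟩, ?_⟩
      rw [map_sum]
      refine Eq.trans (Finset.sum_congr rfl fun b _ => ?_) hS
      exact DirectSum.coeAddMonoidHom_of ..
  compat a b r x hr hx := by
    change g.π (emb a + b) _ = _
    rw [g.π_smul a r hr, show g.π b x = x from hx]
    rfl

end Bigradings

end GradedComplexes

section Duals

variable {K R 𝒜}

section

variable {N N' N'' : Type u} [AddCommGroup N] [Module R N] [AddCommGroup N'] [Module R N']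
  [AddCommGroup N''] [Module R N'']

/-- The bigraded dual: the `K`-linear forms vanishing on almost all homogeneous components. -/
def Gr.dualSubgroup (g : Gr K R 𝒜 N) : AddSubgroup (N →+ K) where
  carrier := {φ | (∀ (c : K) (x : N), φ (algebraMap K R c • x) = c * φ x) ∧
    ∃ S : Finset (ℤ × ℤ), ∀ x, (∀ a ∈ S, g.π a x = 0) → φ x = 0}
  zero_mem' := ⟨fun c x => by simp, ∅, fun x _ => rfl⟩
  add_mem' := by
    rintro φ ψ ⟨hφ, S, hS⟩ ⟨hψ, T, hT⟩
    refine ⟨fun c x => ?_, S ∪ T, fun x hx => ?_⟩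
    · rw [AddMonoidHom.add_apply, AddMonoidHom.add_apply, hφ, hψ, mul_add]
    · rw [AddMonoidHom.add_apply, hS x fun a ha => hx a (Finset.mem_union_left _ ha),
        hT x fun a ha => hx a (Finset.mem_union_right _ ha), add_zero]
  neg_mem' := by
    rintro φ ⟨hφ, S, hS⟩
    refine ⟨fun c x => ?_, S, fun x hx => ?_⟩
    · rw [AddMonoidHom.neg_apply, AddMonoidHom.neg_apply, hφ, mul_neg]
    · rw [AddMonoidHom.neg_apply, hS x hx, neg_zero]

/-- The bigraded dual, as a type. -/
abbrev GDual (g : Gr K R 𝒜 N) : Type u := g.dualSubgroup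

namespace GDual

/-- Evaluation of a form. -/
def ev {g : Gr K R 𝒜 N} (φ : GDual g) : N →+ K := φ.1

lemma ev_ksmul {g : Gr K R 𝒜 N} (φ : GDual g) (c : K) (x : N) :
    φ.ev (algebraMap K R c • x) = c * φ.ev x := φ.2.1 c x

lemma exists_support {g : Gr K R 𝒜 N} (φ : GDual g) :
    ∃ S : Finset (ℤ × ℤ), ∀ x, (∀ a ∈ S, g.π a x = 0) → φ.ev x = 0 := φ.2.2

lemma ext {g : Gr K R 𝒜 N} {φ ψ : GDual g} (h : ∀ x, φ.ev x = ψ.ev x) : φ = ψ :=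
  Subtype.ext (AddMonoidHom.ext h)

lemma ev_add {g : Gr K R 𝒜 N} (φ ψ : GDual g) (x : N) : (φ + ψ).ev x = φ.ev x + ψ.ev x := rfl

lemma ev_zero {g : Gr K R 𝒜 N} (x : N) : (0 : GDual g).ev x = 0 := rfl

lemma ev_sum {ι : Type*} {g : Gr K R 𝒜 N} (S : Finset ι) (φ : ι → GDual g) (x : N) :
    (∑ i ∈ S, φ i).ev x = ∑ i ∈ S, (φ i).ev x := by
  classical
  induction S using Finset.induction_on with
  | empty => rfl
  | insert i S hi ih => rw [Finset.sum_insert hi, Finset.sum_insert hi, ev_add, ih]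

lemma sum_ev {g : Gr K R 𝒜 N} (φ : GDual g) {S : Finset (ℤ × ℤ)}
    (hS : ∀ x, (∀ a ∈ S, g.π a x = 0) → φ.ev x = 0) (x : N) :
    ∑ a ∈ S, φ.ev (g.π a x) = φ.ev x := by
  rw [← map_sum, ← sub_eq_zero, ← map_sub]
  refine hS _ fun a ha => ?_
  rw [map_sub, g.π_sum S x a ha, sub_self]

/-- Composition of a form with a graded map. -/
def dualMapHom (g : Gr K R 𝒜 N) (g' : Gr K R 𝒜 N') (f : N →ₗ[R] N') (hf : g.IsHom g' f) :
    GDual g' →+ GDual g where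
  toFun φ := ⟨φ.ev.comp f.toAddMonoidHom, fun c x => by
    change φ.ev (f _) = c * φ.ev (f x)
    rw [map_smul, ev_ksmul], by
    obtain ⟨S, hS⟩ := φ.exists_support
    refine ⟨S, fun x hx => hS _ fun a ha => ?_⟩
    change g'.π a (f x) = 0
    rw [← hf, hx a ha, map_zero]⟩
  map_zero' := rfl
  map_add' _ _ := rfl

variable [GradedAlgebra 𝒜]

lemma smul_mem (g : Gr K R 𝒜 N) (r : R) (φ : GDual g) :
    φ.ev.comp (DistribSMul.toAddMonoidHom N r) ∈ g.dualSubgroup := by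
  refine ⟨fun c x => ?_, ?_⟩
  · change φ.ev (r • _) = c * φ.ev (r • x)
    rw [smul_comm, ev_ksmul]
  change ∃ S : Finset (ℤ × ℤ), ∀ x, (∀ a ∈ S, g.π a x = 0) → φ.ev (r • x) = 0
  obtain ⟨S, hS⟩ := φ.exists_support
  induction r using DirectSum.Decomposition.inductionOn 𝒜 with
  | zero => exact ⟨∅, fun x _ => by rw [zero_smul, map_zero]⟩
  | @homogeneous i r =>
    refine ⟨S.map (addRightEmbedding (-emb i)), fun x hx => hS _ fun a ha => ?_⟩
    have h := g.π_smul i r r.2 (a + -emb i) x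
    rw [show g.π (a + -emb i) x = 0 from hx _ (Finset.mem_map_of_mem _ ha), smul_zero, add_comm,
      neg_add_cancel_right] at h
    exact h
  | add r r' h h' =>
    obtain ⟨T, hT⟩ := h
    obtain ⟨T', hT'⟩ := h'
    refine ⟨T ∪ T', fun x hx => ?_⟩
    rw [add_smul, map_add, hT x fun a ha => hx a (Finset.mem_union_left _ ha),
      hT' x fun a ha => hx a (Finset.mem_union_right _ ha), add_zero]

instance instModule (g : Gr K R 𝒜 N) : Module R (GDual g) where
  smul r φ := ⟨_, smul_mem g r φ⟩
  one_smul φ := GDual.ext fun x => congrArg φ.ev (one_smul R x)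
  mul_smul r r' φ := GDual.ext fun x => congrArg φ.ev ((mul_comm r r' ▸ mul_smul r' r x :))
  smul_zero _ := rfl
  smul_add _ _ _ := rfl
  add_smul r r' φ := GDual.ext fun x => (congrArg φ.ev (add_smul r r' x)).trans (map_add φ.ev _ _)
  zero_smul φ := GDual.ext fun x => (congrArg φ.ev (zero_smul R x)).trans (map_zero φ.ev)

lemma ev_smul {g : Gr K R 𝒜 N} (r : R) (φ : GDual g) (x : N) : (r • φ).ev x = φ.ev (r • x) := rfl

/-- The dual of a graded map. -/
def dualMap (g : Gr K R 𝒜 N) (g' : Gr K R 𝒜 N') (f : N →ₗ[R] N') (hf : g.IsHom g' f) :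
    GDual g' →ₗ[R] GDual g where
  toFun := dualMapHom g g' f hf
  map_add' := map_add _
  map_smul' r φ := GDual.ext fun x => congrArg φ.ev (f.map_smul r x).symm

/-- The component of a form. -/
def proj (g : Gr K R 𝒜 N) (b : ℤ × ℤ) : GDual g →+ GDual g where
  toFun φ := ⟨φ.ev.comp (g.π (-b)), fun c x => by
    change φ.ev (g.π (-b) _) = c * φ.ev (g.π (-b) x)
    rw [g.π_ksmul, ev_ksmul], {-b}, fun x hx => by
      change φ.ev (g.π (-b) x) = 0
      rw [hx _ (Finset.mem_singleton_self _), map_zero]⟩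
  map_zero' := rfl
  map_add' _ _ := rfl

lemma proj_ev (g : Gr K R 𝒜 N) (b : ℤ × ℤ) (φ : GDual g) (x : N) :
    (proj g b φ).ev x = φ.ev (g.π (-b) x) := rfl

/-- The bigrading on the dual. -/
def gr (g : Gr K R 𝒜 N) : Gr K R 𝒜 (GDual g) where
  π := proj g
  π_self a φ := GDual.ext fun x => congrArg φ.ev (g.π_self (-a) x)
  π_ne a b φ h := GDual.ext fun x => by
    rw [proj_ev, proj_ev, g.π_ne _ _ _ fun e => h (neg_injective e).symm, map_zero, ev_zero]
  sum_π φ := by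
    obtain ⟨S, hS⟩ := φ.exists_support
    refine ⟨S.map (Equiv.neg _).toEmbedding, GDual.ext fun x => ?_⟩
    rw [ev_sum, Finset.sum_map, ← φ.sum_ev hS x]
    refine Finset.sum_congr rfl fun a _ => ?_
    rw [proj_ev]
    exact congrArg (fun c => φ.ev (g.π c x)) (neg_neg a)
  π_smul a r hr b φ := GDual.ext fun x => by
    rw [proj_ev, ev_smul, ev_smul, proj_ev, ← g.π_smul a r hr]
    congr 3
    abel

lemma exists_extend (g : Gr K R 𝒜 N) (g' : Gr K R 𝒜 N') (f : N →ₗ[R] N') (hf : g.IsHom g' f)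
    (φ : GDual g) (hφ : ∀ x, f x = 0 → φ.ev x = 0) :
    ∃ ψ : GDual g', ∀ x, ψ.ev (f x) = φ.ev x := by
  obtain ⟨S, hS⟩ := φ.exists_support
  let _ : Module K N := Module.compHom N (algebraMap K R)
  let _ : Module K N' := Module.compHom N' (algebraMap K R)
  let fK : N →ₗ[K] N' := { toFun := f, map_add' := map_add f, map_smul' := fun c x => map_smul f _ x }
  let φK : N →ₗ[K] K :=
    { toFun := φ.ev, map_add' := map_add φ.ev, map_smul' := fun c x => φ.ev_ksmul c x }
  obtain ⟨ψ, hψ⟩ : φK ∈ LinearMap.range fK.dualMap := by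
    rw [LinearMap.range_dualMap_eq_dualAnnihilator_ker, Submodule.mem_dualAnnihilator]
    exact hφ
  have hψ' (x : N) : ψ (f x) = φ.ev x := LinearMap.congr_fun hψ x
  have hmem (a : ℤ × ℤ) : ψ.toAddMonoidHom.comp (g'.π a) ∈ g'.dualSubgroup := by
    refine ⟨fun c x => ?_, {a}, fun x hx => ?_⟩
    · change ψ (g'.π a _) = c * ψ (g'.π a x)
      rw [g'.π_ksmul]
      exact ψ.map_smul c _
    · change ψ (g'.π a x) = 0
      rw [hx a (Finset.mem_singleton_self _), map_zero]
  refine ⟨∑ a ∈ S, ⟨_, hmem a⟩, fun x => ?_⟩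
  rw [ev_sum, ← φ.sum_ev hS]
  refine Finset.sum_congr rfl fun a _ => ?_
  change ψ (g'.π a (f x)) = _
  rw [← hf, hψ']

/-- Every form on the component of degree `-a` is the restriction of a form of degree `a`. -/
lemma exists_proj_eq (g : Gr K R 𝒜 N) (a : ℤ × ℤ) (φ : N →+ K)
    (hφ : ∀ (c : K) (x : N), φ (algebraMap K R c • x) = c * φ x) :
    ∃ d : GDual g, ∀ x, d.ev x = φ (g.π (-a) x) := by
  refine ⟨⟨φ.comp (g.π (-a)), fun c x => ?_, {-a}, fun x hx => ?_⟩, fun x => rfl⟩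
  · change φ (g.π (-a) _) = c * φ (g.π (-a) x)
    rw [g.π_ksmul, hφ]
  · change φ (g.π (-a) x) = 0
    rw [hx _ (Finset.mem_singleton_self _), map_zero]

end GDual

variable [GradedAlgebra 𝒜]

/-- The bigraded Matlis dual of a module isomorphic to a bigraded module. -/
def Gr.dualData (g : Gr K R 𝒜 N) (e : N' ≃ₗ[R] N) : DualData K R 𝒜 N' where
  src := (g.congr e).toBigrading
  D := GDual g
  bg := (GDual.gr g).toBigrading
  pairing := AddMonoidHom.mk' (fun φ => φ.ev.comp e.toLinearMap.toAddMonoidHom) fun φ ψ => rfl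
  pairing_smul r d x := congrArg d.ev (e.map_smul r x).symm
  pairing_ksmul c d x := d.ev_ksmul c (e x)
  orth a b hab d hd x hx := by
    have hd' : GDual.proj g a d = d := hd
    have hx' : e (e.symm (g.π b (e x))) = e x := congrArg e hx
    rw [e.apply_symm_apply] at hx'
    change d.ev (e x) = 0
    rw [← hd', GDual.proj_ev, ← hx', g.π_ne, map_zero]
    rintro rfl
    exact hab (add_neg_cancel a)
  nondeg a d hd h := by
    have hd' : GDual.proj g a d = d := hd
    rw [← hd']
    refine GDual.ext fun x => ?_
    rw [GDual.proj_ev, GDual.ev_zero]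
    have := h (e.symm (g.π (-a) x)) (congrArg e.symm (by simp [g.π_self]))
    exact (congrArg d.ev (e.apply_symm_apply _)).symm.trans this
  full a φ hφ := by
    let φ' : N →+ K := φ.comp e.symm.toLinearMap.toAddMonoidHom
    obtain ⟨d, hd⟩ := GDual.exists_proj_eq g a φ' fun c x =>
      (congrArg φ (e.symm.map_smul _ x)).trans (hφ c _)
    refine ⟨d, GDual.ext fun x => ?_, fun x hx => ?_⟩
    · change (GDual.proj g a d).ev x = _
      exact (hd _).trans ((congrArg φ' (g.π_self (-a) x)).trans (hd x).symm)
    · have hx' : e.symm (g.π (-a) (e x)) = x := hx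
      exact (hd (e x)).trans (congrArg φ hx')

end

end Duals

section DualComplexes

variable {K R 𝒜}

open DiffModule GDual

namespace GrD

variable [GradedAlgebra 𝒜] {A B C : DiffModule R}

/-- The bigraded dual of a bigraded complex. -/
def dual (g : GrD 𝒜 A) : DiffModule R where
  carrier := GDual g.toGr
  d := dualMap g.toGr g.toGr A.d g.d_π
  p n := dualMap g.toGr g.toGr (A.p (-n)) (g.p_π (-n))
  d_d φ := GDual.ext fun x => (congrArg φ.ev (A.d_d x)).trans (map_zero φ.ev)
  d_p n φ := GDual.ext fun x => by
    have h := A.d_p (-(n + 1)) x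
    rw [show -(n + 1) + 1 = -n by ring] at h
    exact congrArg φ.ev h.symm
  p_p_self n φ := GDual.ext fun x => congrArg φ.ev (A.p_p_self (-n) x)
  p_p_ne n m φ h := GDual.ext fun x =>
    (congrArg φ.ev (A.p_p_ne (-m) (-n) x fun e => h (neg_injective e).symm)).trans
      (map_zero φ.ev)
  sum_p := by
    obtain ⟨S, hS⟩ := A.sum_p
    refine ⟨S.map (Equiv.neg _).toEmbedding, fun φ => GDual.ext fun x => ?_⟩
    rw [Finset.sum_map]
    refine (ev_sum _ _ _).trans (Eq.trans ?_ (congrArg φ.ev (hS x)))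
    rw [map_sum]
    exact Finset.sum_congr rfl fun n _ => congrArg (fun c => φ.ev (A.p c x)) (neg_neg n)

/-- The dual of a morphism of bigraded complexes. -/
def dualHom (g : GrD 𝒜 A) (g' : GrD 𝒜 B) (f : Hom A B) (hf : g.IsHom g'.toGr f.f) :
    Hom g'.dual g.dual where
  f := dualMap g.toGr g'.toGr f.f hf
  f_d φ := GDual.ext fun x => congrArg (GDual.ev (g := g'.toGr) φ) (f.f_d x).symm
  f_p n φ := GDual.ext fun x => congrArg (GDual.ev (g := g'.toGr) φ) (f.f_p (-n) x).symm

lemma shortExact_dual (g : GrD 𝒜 A) (g' : GrD 𝒜 B) (g'' : GrD 𝒜 C) {f : Hom A B} {h : Hom B C}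
    (hf : g.IsHom g'.toGr f.f) (hh : g'.IsHom g''.toGr h.f) (H : ShortExact f h) :
    ShortExact (g'.dualHom g'' h hh) (g.dualHom g' f hf) where
  inj := by
    intro φ ψ e
    refine GDual.ext fun x => ?_
    obtain ⟨y, rfl⟩ := H.surj x
    exact congrArg (fun χ => GDual.ev (g := g'.toGr) χ y) e
  exact := by
    intro φ
    constructor
    · intro h0
      obtain ⟨ψ, hψ⟩ := exists_extend g'.toGr g''.toGr h.f hh φ fun x hx => by
        obtain ⟨a, rfl⟩ := (H.exact x).1 hx
        exact congrArg (fun χ => GDual.ev (g := g.toGr) χ a) h0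
      exact ⟨ψ, GDual.ext hψ⟩
    · rintro ⟨ψ, rfl⟩
      refine GDual.ext fun x => ?_
      exact (congrArg (GDual.ev (g := g''.toGr) ψ) ((H.exact _).2 ⟨x, rfl⟩)).trans (map_zero _)
  surj := by
    intro φ
    obtain ⟨ψ, hψ⟩ := exists_extend g.toGr g'.toGr f.f hf φ fun x hx => by
      rw [show x = 0 from H.inj (hx.trans (map_zero f.f).symm), map_zero]
    exact ⟨ψ, GDual.ext hψ⟩

/-- Evaluation of a cocycle of the dual on cohomology classes. -/
lemma exists_evalH (g : GrD 𝒜 A) (n : ℤ) (φ : g.dual.Z n) :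
    ∃ ψ : GDual (g.H (-n)), ∀ z : A.Z (-n), ψ.ev (A.cls (-n) z) =
      GDual.ev (g := g.toGr) φ.1 z.1 := by
  obtain ⟨φ, hφ⟩ := φ
  have hd (y : A) : GDual.ev (g := g.toGr) φ (A.d y) = 0 :=
    congrArg (fun χ => GDual.ev (g := g.toGr) χ y) (mem_Z.1 hφ).1
  let ψ : A.H (-n) →+ K := QuotientAddGroup.lift _
    ((GDual.ev (g := g.toGr) φ).comp (A.Z (-n)).subtype.toAddMonoidHom) (by
      rintro x ⟨y, hy⟩
      exact (congrArg (GDual.ev (g := g.toGr) φ) hy.symm).trans (hd y))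
  have hψ (z : A.Z (-n)) : ψ (A.cls (-n) z) = GDual.ev (g := g.toGr) φ z.1 := rfl
  refine ⟨⟨ψ, fun c x => ?_, ?_⟩, hψ⟩
  · obtain ⟨z, rfl⟩ := A.cls_surjective _ x
    exact GDual.ev_ksmul (g := g.toGr) φ c z.1
  · obtain ⟨S, hS⟩ := GDual.exists_support (g := g.toGr) φ
    refine ⟨S, fun x hx => ?_⟩
    obtain ⟨z, rfl⟩ := A.cls_surjective _ x
    have h := GDual.sum_ev (g := g.toGr) φ hS z.1
    rw [hψ, ← h]
    refine Finset.sum_eq_zero fun a ha => ?_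
    obtain ⟨z', hz', hz''⟩ := g.H_π_cls (-n) a z
    rw [← hz', ← hψ, ← hz'', hx a ha, map_zero]

/-- Evaluation of a cocycle of the dual on cohomology classes. -/
def evalZ (g : GrD 𝒜 A) (n : ℤ) : g.dual.Z n →ₗ[R] GDual (g.H (-n)) where
  toFun φ := (g.exists_evalH n φ).choose
  map_add' φ ψ := GDual.ext fun x => by
    obtain ⟨z, rfl⟩ := A.cls_surjective _ x
    rw [ev_add, (g.exists_evalH n _).choose_spec, (g.exists_evalH n _).choose_spec,
      (g.exists_evalH n _).choose_spec]
    rfl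
  map_smul' r φ := GDual.ext fun x => by
    obtain ⟨z, rfl⟩ := A.cls_surjective _ x
    rw [RingHom.id_apply, ev_smul, ← map_smul, (g.exists_evalH n _).choose_spec,
      (g.exists_evalH n _).choose_spec]
    rfl

lemma evalZ_ev (g : GrD 𝒜 A) (n : ℤ) (φ : g.dual.Z n) (z : A.Z (-n)) :
    (g.evalZ n φ).ev (A.cls (-n) z) = GDual.ev (g := g.toGr) φ.1 z.1 :=
  (g.exists_evalH n φ).choose_spec z

lemma evalZ_eq_zero (g : GrD 𝒜 A) (n : ℤ) (φ : g.dual.Z n) (h : g.evalZ n φ = 0) :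
    ∃ ψ, g.dual.d ψ = φ.1 := by
  have hz (z : A) (hz : A.d z = 0) : GDual.ev (g := g.toGr) φ.1 z = 0 := by
    have hp := congrArg (fun χ => GDual.ev (g := g.toGr) χ z) (mem_Z.1 φ.2).2
    have hz' : A.p (-n) z ∈ A.Z (-n) := mem_Z.2 ⟨by rw [A.d_p, hz, map_zero], A.p_p_self _ _⟩
    refine hp.symm.trans ((g.evalZ_ev n φ ⟨_, hz'⟩).symm.trans ?_)
    rw [h, ev_zero]
  obtain ⟨ψ, hψ⟩ := exists_extend g.toGr g.toGr A.d g.d_π φ.1 hz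
  exact ⟨ψ, GDual.ext hψ⟩

lemma evalZ_surjective (g : GrD 𝒜 A) (n : ℤ) : Function.Surjective (g.evalZ n) := by
  intro ψ
  let W : Submodule R A := LinearMap.range A.d
  have hW (b : ℤ × ℤ) (x : A) (hx : x ∈ W) : g.π b x ∈ W := by
    obtain ⟨y, rfl⟩ := hx
    exact ⟨g.π b y, g.d_π b y⟩
  let f : A.H (-n) →ₗ[R] (A ⧸ W) := Submodule.mapQ _ W (A.Z (-n)).subtype le_rfl
  have hf : (g.H (-n)).IsHom (g.toGr.quot W hW) f := by
    intro b x
    obtain ⟨z, rfl⟩ := A.cls_surjective _ x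
    rfl
  obtain ⟨χ, hχ⟩ := exists_extend (g.H (-n)) (g.toGr.quot W hW) f hf ψ fun x hx => by
    obtain ⟨z, rfl⟩ := A.cls_surjective _ x
    rw [cls_eq_zero.2 ((Submodule.Quotient.mk_eq_zero W).1 hx), map_zero]
  let θ : g.dual := dualMap g.toGr (g.toGr.quot W hW) W.mkQ (fun _ _ => rfl) χ
  have hd : g.dual.d θ = 0 := GDual.ext fun x =>
    (congrArg χ.ev ((Submodule.Quotient.mk_eq_zero W).2 ⟨x, rfl⟩)).trans (map_zero _)
  have hθ : g.dual.p n θ ∈ g.dual.Z n :=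
    mem_Z.2 ⟨by rw [g.dual.d_p, hd, map_zero], g.dual.p_p_self _ _⟩
  refine ⟨⟨_, hθ⟩, GDual.ext fun x => ?_⟩
  obtain ⟨z, rfl⟩ := A.cls_surjective _ x
  rw [evalZ_ev, ← hχ]
  exact congrArg (fun y => χ.ev (W.mkQ y)) (mem_Z.1 z.2).2

/-- The cohomology of the dual is the dual of the cohomology. -/
def dualHEquiv (g : GrD 𝒜 A) (n : ℤ) : g.dual.H n ≃ₗ[R] GDual (g.H (-n)) :=
  (Submodule.quotEquivOfEq _ _ (by
    ext φ
    rw [LinearMap.mem_ker]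
    constructor
    · rintro ⟨ψ, hψ⟩
      refine GDual.ext fun x => ?_
      obtain ⟨z, rfl⟩ := A.cls_surjective _ x
      rw [evalZ_ev, ev_zero]
      refine (congrArg (fun χ => GDual.ev (g := g.toGr) χ z.1) hψ).symm.trans ?_
      exact (congrArg (GDual.ev (g := g.toGr) ψ) (mem_Z.1 z.2).1).trans (map_zero _)
    · exact g.evalZ_eq_zero n φ)).trans
    ((g.evalZ n).quotKerEquivOfSurjective (g.evalZ_surjective n))

end GrD

end DualComplexes

section Comparison

variable {K R 𝒜}

open DiffModule GDual

section

variable {N : Type u} [AddCommGroup N] [Module R N]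

lemma GDual.subsingleton (g : Gr K R 𝒜 N) [Subsingleton N] : Subsingleton (GDual g) :=
  ⟨fun φ ψ => GDual.ext fun x => by rw [Subsingleton.elim x 0, map_zero, map_zero]⟩

variable [GradedAlgebra 𝒜]

lemma GDual.bijective_smul (g : Gr K R 𝒜 N) {e : ℕ × ℕ} {x : R} (hx : x ∈ 𝒜 e)
    (h : Function.Bijective fun y : N => x • y) :
    Function.Bijective fun φ : GDual g => x • φ := by
  constructor
  · intro φ ψ hφψ
    refine GDual.ext fun y => ?_
    obtain ⟨z, rfl⟩ := h.2 y
    exact congrArg (fun χ : GDual g => χ.ev z) hφψ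
  · intro φ
    let E : N ≃ₗ[R] N := LinearEquiv.ofBijective (LinearMap.lsmul R N x) h
    have hE (y : N) : E.symm (x • y) = y := E.symm_apply_apply y
    have hE' (y : N) : x • E.symm y = y := E.apply_symm_apply y
    have hmem : φ.ev.comp E.symm.toLinearMap.toAddMonoidHom ∈ g.dualSubgroup := by
      refine ⟨fun c y => ?_, ?_⟩
      · exact (congrArg φ.ev (E.symm.map_smul _ y)).trans (φ.ev_ksmul c _)
      · obtain ⟨S, hS⟩ := φ.exists_support
        refine ⟨S.map (addLeftEmbedding (emb e)), fun y hy => ?_⟩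
        change φ.ev (E.symm y) = 0
        refine hS _ fun a ha => h.1 ?_
        change x • g.π a (E.symm y) = x • 0
        rw [← g.π_smul e x hx, hE', smul_zero]
        exact hy _ (Finset.mem_map_of_mem _ ha)
    exact ⟨⟨_, hmem⟩, GDual.ext fun y => congrArg φ.ev (hE y)⟩

lemma GDual.exists_pow_smul_eq_zero (g : Gr K R 𝒜 N) {B : ℤ} (hB : g.Bounded B) {x : R}
    (hx : x ∈ 𝒜 (1, 0)) (φ : GDual g) : ∃ t : ℕ, x ^ t • φ = 0 := by
  obtain ⟨S, hS⟩ := φ.exists_support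
  obtain ⟨t, ht⟩ : ∃ t : ℕ, ∀ a ∈ S, a.1 - t < B := by
    refine ⟨∑ a ∈ S, (a.1 - B + 1).toNat, fun a ha => ?_⟩
    have : (a.1 - B + 1).toNat ≤ ∑ a ∈ S, (a.1 - B + 1).toNat :=
      Finset.single_le_sum (f := fun a : ℤ × ℤ => (a.1 - B + 1).toNat)
        (fun _ _ => Nat.zero_le _) ha
    omega
  refine ⟨t, GDual.ext fun y => ?_⟩
  rw [ev_smul, ev_zero]
  refine hS _ fun a ha => ?_
  have h := g.π_pow_smul hx t (a - t • emb (1, 0)) y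
  rw [sub_add_cancel] at h
  rw [h, hB, smul_zero]
  simpa [emb] using ht a ha

end

section

variable [GradedAlgebra 𝒜] {A : DiffModule R}

/-- Replacing a complex by its cone along an element of `L` in the dual does not change the
cohomology of the iterated cone along `L`. -/
lemma GrD.nonempty_H_dual_cone_equiv (g : GrD 𝒜 A) {e : ℕ × ℕ} {x : R} (hx : x ∈ 𝒜 e)
    {L : List R} (hL : x ∈ L) (n : ℤ) :
    Nonempty ((g.dual.coneL L).H n ≃ₗ[R] ((g.cone hx).dual.coneL L).H n) := by
  have h := GrD.shortExact_dual (g.loc hx) (g.cone hx) g (f := coneInr x A) (h := coneFst x A)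
    (fun b u => Prod.ext (map_zero (g.π b)).symm rfl) (fun _ _ => rfl) (shortExact_cone x A)
  refine ⟨LinearEquiv.ofBijective _ ((h.coneL L).bijective_of_acyclic_right ?_ n)⟩
  refine isAcyclic_coneL_of_bijective hL (GDual.bijective_smul _ hx ⟨fun y z hyz => ?_, fun y => ?_⟩)
  · exact sub_eq_zero.1 (eq_zero_of_smul_eq_zero x ((smul_sub x y z).trans (sub_eq_zero.2 hyz)))
  · exact exists_pow_smul_eq x y

lemma GrD.nonempty_H_dual_coneL_equiv (g : GrD 𝒜 A) {e : ℕ × ℕ} {L : List R} (L' : List R)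
    (hL' : ∀ x ∈ L', x ∈ L) (he : ∀ x ∈ L', x ∈ 𝒜 e) (n : ℤ) :
    Nonempty ((g.dual.coneL L).H n ≃ₗ[R] ((g.coneL e L' he).dual.coneL L).H n) := by
  induction L' generalizing A with
  | nil => exact ⟨LinearEquiv.refl _ _⟩
  | cons x L' ih =>
    obtain ⟨E⟩ := g.nonempty_H_dual_cone_equiv (he x List.mem_cons_self)
      (hL' x List.mem_cons_self) n
    obtain ⟨E'⟩ := ih (g.cone (he x List.mem_cons_self))
      (fun y hy => hL' y (List.mem_cons_of_mem _ hy))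
      (fun y hy => he y (List.mem_cons_of_mem _ hy))
    exact ⟨E.trans E'⟩

end

/-- Iterated cones do not change the cohomology of torsion complexes. -/
lemma DiffModule.nonempty_H_coneL_equiv_of_torsion (L : List R) {A : DiffModule R}
    (h : ∀ x ∈ L, ∀ a : A, ∃ t : ℕ, x ^ t • a = 0) (n : ℤ) :
    Nonempty ((A.coneL L).H n ≃ₗ[R] A.H n) := by
  induction L generalizing A with
  | nil => exact ⟨LinearEquiv.refl _ _⟩
  | cons x L ih =>
    have h0 (u : Loc x A) : u = 0 := by
      obtain ⟨a, k, rfl⟩ := exists_frac u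
      exact frac_eq_zero.2 (h x List.mem_cons_self a)
    obtain ⟨E⟩ := ih (A := A.cone x) fun y hy a => by
      obtain ⟨t, ht⟩ := h y (List.mem_cons_of_mem _ hy) a.1
      exact ⟨t, Prod.ext ht (h0 _)⟩
    exact ⟨E.trans (LinearEquiv.ofBijective _ ((shortExact_cone x A).bijective_of_acyclic_left
      (fun z _ => ⟨0, (h0 _).trans (h0 z).symm⟩) n))⟩

end Comparison

section Truncation

variable {R}

namespace DiffModule

lemma Hom.bijective_map_coneL_of_homogeneous {A B : DiffModule R} (f : Hom A B)
    (hf : Function.Injective f.f)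
    (h : ∀ n b a, B.p n b = b → B.d b = f.f a → ∃ c a', b = B.d c + f.f a') (L : List R) (n : ℤ) :
    Function.Bijective ((f.coneL L).map n) := by
  refine f.bijective_map_coneL hf (fun b a hb => ?_) L n
  obtain ⟨S, hS⟩ := B.sum_p
  have H (n : ℤ) : ∃ c a', B.p n b = B.d c + f.f a' :=
    h n (B.p n b) (A.p (n + 1) a) (B.p_p_self n b) (by rw [B.d_p, hb, f.f_p])
  choose c a' hca using H
  refine ⟨∑ n ∈ S, c n, ∑ n ∈ S, a' n, ?_⟩
  rw [map_sum, map_sum, ← Finset.sum_add_distrib]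
  exact (hS b).symm.trans (Finset.sum_congr rfl fun n _ => hca n)

lemma p_eq_zero_of_p_eq {A : DiffModule R} {n m : ℤ} {x : A} (hx : A.p n x = x) (h : m ≠ n) :
    A.p m x = 0 := by
  rw [← hx, A.p_p_ne _ _ _ h]

lemma exists_d_eq_of_subsingleton {A : DiffModule R} {n : ℤ} (h : Subsingleton (A.H n)) {x : A}
    (hx : A.p n x = x) (hd : A.d x = 0) : ∃ y, A.d y = x :=
  cls_eq_zero.1 (Subsingleton.elim (A.cls n ⟨x, mem_Z.2 ⟨hd, hx⟩⟩) 0)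

/-- Subcomplexes. -/
def sub (A : DiffModule R) (W : Submodule R A) (hd : ∀ x ∈ W, A.d x ∈ W)
    (hp : ∀ n, ∀ x ∈ W, A.p n x ∈ W) : DiffModule R where
  carrier := W
  d := A.d.restrict hd
  p n := (A.p n).restrict (hp n)
  d_d x := Subtype.ext (A.d_d x)
  d_p n x := Subtype.ext (A.d_p n x)
  p_p_self n x := Subtype.ext (A.p_p_self n x)
  p_p_ne n m x h := Subtype.ext (A.p_p_ne n m x h)
  sum_p := by
    obtain ⟨S, hS⟩ := A.sum_p
    exact ⟨S, fun x => Subtype.ext ((AddSubmonoidClass.coe_finsetSum _ _).trans (hS x))⟩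

/-- The inclusion of a subcomplex. -/
def subHom (A : DiffModule R) (W : Submodule R A) (hd : ∀ x ∈ W, A.d x ∈ W)
    (hp : ∀ n, ∀ x ∈ W, A.p n x ∈ W) : Hom (A.sub W hd hp) A where
  f := W.subtype
  f_d _ := rfl
  f_p _ _ := rfl

variable (A : DiffModule R) (b : ℤ)

/-- The submodule underlying the truncation in degrees at most `b`. -/
def leSubmodule : Submodule R A where
  carrier := {x | (∀ n, b < n → A.p n x = 0) ∧ A.d (A.p b x) = 0}
  zero_mem' := by simp
  add_mem' := fun hx hy =>
    ⟨fun n hn => by rw [map_add, hx.1 n hn, hy.1 n hn, add_zero],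
      by rw [map_add, map_add, hx.2, hy.2, add_zero]⟩
  smul_mem' := fun r x hx =>
    ⟨fun n hn => by rw [map_smul, hx.1 n hn, smul_zero], by rw [map_smul, map_smul, hx.2, smul_zero]⟩

/-- The submodule underlying the truncation in degrees less than `b`. -/
def ltSubmodule : Submodule R A where
  carrier := {x | (∀ n, b < n → A.p n x = 0) ∧ ∃ y, A.d y = A.p b x}
  zero_mem' := ⟨by simp, 0, by simp⟩
  add_mem' := by
    rintro x x' ⟨hx, y, hy⟩ ⟨hx', y', hy'⟩
    exact ⟨fun n hn => by rw [map_add, hx n hn, hx' n hn, add_zero],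
      y + y', by rw [map_add, map_add, hy, hy']⟩
  smul_mem' := by
    rintro r x ⟨hx, y, hy⟩
    exact ⟨fun n hn => by rw [map_smul, hx n hn, smul_zero],
      r • y, by rw [map_smul, map_smul, hy]⟩

variable {A b}

lemma mem_leSubmodule {x : A} :
    x ∈ A.leSubmodule b ↔ (∀ n, b < n → A.p n x = 0) ∧ A.d (A.p b x) = 0 := Iff.rfl

lemma ltSubmodule_le : A.ltSubmodule b ≤ A.leSubmodule b := by
  rintro x ⟨hx, y, hy⟩
  exact ⟨hx, by rw [← hy, A.d_d]⟩

lemma p_d (n : ℤ) (x : A) : A.p n (A.d x) = A.d (A.p (n - 1) x) := by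
  rw [A.d_p, sub_add_cancel]

lemma d_mem_ltSubmodule {x : A} (hx : x ∈ A.leSubmodule b) : A.d x ∈ A.ltSubmodule b := by
  rw [mem_leSubmodule] at hx
  refine ⟨fun n hn => ?_, A.p (b - 1) x, (p_d b x).symm⟩
  rw [p_d]
  obtain h | rfl : b < n - 1 ∨ b = n - 1 := by omega
  · rw [hx.1 _ h, map_zero]
  · exact hx.2

lemma p_mem_leSubmodule (n : ℤ) {x : A} (hx : x ∈ A.leSubmodule b) : A.p n x ∈ A.leSubmodule b := by
  rw [mem_leSubmodule] at hx ⊢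
  constructor
  · intro m hm
    by_cases h : m = n
    · subst h
      rw [hx.1 m hm, map_zero]
    · exact A.p_p_ne _ _ _ h
  · by_cases h : b = n
    · subst h
      rw [A.p_p_self, hx.2]
    · rw [A.p_p_ne _ _ _ h, map_zero]

lemma p_mem_ltSubmodule (n : ℤ) {x : A} (hx : x ∈ A.ltSubmodule b) : A.p n x ∈ A.ltSubmodule b := by
  refine ⟨(p_mem_leSubmodule n (ltSubmodule_le hx)).1, ?_⟩
  by_cases h : b = n
  · subst h
    rw [A.p_p_self]
    exact hx.2
  · exact ⟨0, by rw [A.p_p_ne _ _ _ h, map_zero]⟩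

variable (A b) in
/-- The truncation in degrees at most `b`. -/
def truncLE : DiffModule R :=
  A.sub (A.leSubmodule b) (fun _ hx => ltSubmodule_le (d_mem_ltSubmodule hx))
    fun n _ hx => p_mem_leSubmodule n hx

variable (A b) in
/-- The truncation in degrees less than `b`. -/
def truncLT : DiffModule R :=
  A.sub (A.ltSubmodule b) (fun _ hx => d_mem_ltSubmodule (ltSubmodule_le hx))
    fun n _ hx => p_mem_ltSubmodule n hx

variable (A b) in
/-- The inclusion of truncations. -/
def truncLTHom : Hom (A.truncLT b) (A.truncLE b) where
  f := Submodule.inclusion ltSubmodule_le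
  f_d _ := rfl
  f_p _ _ := rfl

variable (A b) in
/-- The projection from a truncation to the top cohomology. -/
def truncLEHom : Hom (A.truncLE b) (single (R := R) b (A.H b)) where
  f := (A.cls b).comp (((A.p b).comp (A.leSubmodule b).subtype).codRestrict (A.Z b) fun x =>
    mem_Z.2 ⟨x.2.2, A.p_p_self _ _⟩)
  f_d x := cls_eq_zero.2 ⟨A.p (b - 1) x.1, (p_d b x.1).symm⟩
  f_p n x := by
    by_cases h : n = b
    · subst h
      refine Eq.trans (congrArg (A.cls n) (Subtype.ext ?_)) (single_p_self (R := R) n _).symm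
      exact A.p_p_self n x.1
    · refine Eq.trans ?_ (single_p_ne (R := R) h _).symm
      exact cls_eq_zero.2 ⟨0, (map_zero A.d).trans (A.p_p_ne b n x.1 (Ne.symm h)).symm⟩

lemma shortExact_trunc : ShortExact (A.truncLTHom b) (A.truncLEHom b) where
  inj := Submodule.inclusion_injective ltSubmodule_le
  exact := by
    rintro ⟨x, hx⟩
    refine cls_eq_zero.trans ⟨fun h => ⟨⟨x, hx.1, h⟩, rfl⟩, ?_⟩
    rintro ⟨⟨x', hx'⟩, h⟩
    obtain rfl : x' = x := congrArg Subtype.val h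
    exact hx'.2
  surj := by
    intro c
    obtain ⟨⟨z, hz⟩, rfl⟩ := A.cls_surjective b c
    have hz' := mem_Z.1 hz
    refine ⟨⟨z, fun n hn => p_eq_zero_of_p_eq hz'.2 hn.ne', by rw [hz'.2, hz'.1]⟩, ?_⟩
    exact congrArg (A.cls b) (Subtype.ext hz'.2)

lemma mem_leSubmodule_of_lt {n : ℤ} {x : A} (hx : A.p n x = x) (h : n < b) :
    x ∈ A.leSubmodule b :=
  ⟨fun m hm => p_eq_zero_of_p_eq hx (by omega), by rw [p_eq_zero_of_p_eq hx (by omega), map_zero]⟩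

lemma mem_ltSubmodule_of_lt {n : ℤ} {x : A} (hx : A.p n x = x) (h : n < b) :
    x ∈ A.ltSubmodule b :=
  ⟨fun m hm => p_eq_zero_of_p_eq hx (by omega), 0,
    by rw [p_eq_zero_of_p_eq hx (by omega), map_zero]⟩

lemma isAcyclic_truncLT (h : ∀ n < b, Subsingleton (A.H n)) : (A.truncLT b).IsAcyclic := by
  rintro ⟨z, hz⟩ hdz
  have hdz' : A.d z = 0 := congrArg Subtype.val hdz
  obtain ⟨S, hS⟩ := A.sum_p
  have H (n : ℤ) : ∃ y ∈ A.ltSubmodule b, A.d y = A.p n z := by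
    obtain hn | rfl | hn := lt_trichotomy n b
    · obtain ⟨y, hy, hyp⟩ := exists_d_eq (n := n - 1) (x := A.p n z)
        (by rw [sub_add_cancel, A.p_p_self])
        (exists_d_eq_of_subsingleton (h n hn) (A.p_p_self n z) (by rw [A.d_p, hdz', map_zero]))
      exact ⟨y, mem_ltSubmodule_of_lt hyp (by omega), hy⟩
    · obtain ⟨y, hy, hyp⟩ := exists_d_eq (n := n - 1) (x := A.p n z)
        (by rw [sub_add_cancel, A.p_p_self]) hz.2
      exact ⟨y, mem_ltSubmodule_of_lt hyp (by omega), hy⟩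
    · exact ⟨0, zero_mem _, by rw [map_zero, hz.1 n hn]⟩
  choose y hy hyd using H
  refine ⟨⟨∑ n ∈ S, y n, sum_mem fun n _ => hy n⟩, Subtype.ext ?_⟩
  change A.d (∑ n ∈ S, y n) = z
  rw [map_sum, ← Finset.sum_congr rfl fun n _ => (hyd n).symm, hS]

lemma leSubmodule_le : A.leSubmodule b ≤ A.ltSubmodule (b + 1) := fun x hx =>
  ⟨fun n hn => hx.1 n (by omega), 0, by rw [hx.1 (b + 1) (by omega), map_zero]⟩

variable (A b) in
/-- The inclusion of truncations. -/
def truncLEHomLT : Hom (A.truncLE b) (A.truncLT (b + 1)) where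
  f := Submodule.inclusion leSubmodule_le
  f_d _ := rfl
  f_p _ _ := rfl

lemma bijective_map_coneL_truncLEHomLT (L : List R) (n : ℤ) :
    Function.Bijective (((A.truncLEHomLT b).coneL L).map n) := by
  refine Hom.bijective_map_coneL_of_homogeneous _ (Submodule.inclusion_injective leSubmodule_le) ?_ L n
  rintro n ⟨x, hx⟩ ⟨y, hy⟩ hp hd
  replace hp : A.p n x = x := congrArg Subtype.val hp
  replace hd : A.d x = y := congrArg Subtype.val hd
  suffices x ∈ A.leSubmodule b ∨ ∃ c ∈ A.ltSubmodule (b + 1), A.d c = x by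
    obtain h | ⟨c, hc, rfl⟩ := this
    · exact ⟨0, ⟨x, h⟩, Subtype.ext (((congrArg (· + x) (map_zero A.d)).trans (zero_add x)).symm)⟩
    · exact ⟨⟨c, hc⟩, 0, Subtype.ext (add_zero _).symm⟩
  obtain h | rfl | rfl | h : n < b ∨ n = b ∨ n = b + 1 ∨ b + 1 < n := by omega
  · exact Or.inl (mem_leSubmodule_of_lt hp h)
  · refine Or.inl ⟨fun m hm => p_eq_zero_of_p_eq hp hm.ne', ?_⟩
    rw [A.d_p, hd]
    exact hy.1 _ (by omega)
  · obtain ⟨c, hc, hcp⟩ := exists_d_eq hp (hp ▸ hx.2)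
    exact Or.inr ⟨c, mem_ltSubmodule_of_lt hcp (by omega), hc⟩
  · refine Or.inl ?_
    rw [← hp, hx.1 n h]
    exact zero_mem _

lemma bijective_map_coneL_truncLE (h : ∀ n, b < n → Subsingleton (A.H n)) (L : List R) (n : ℤ) :
    Function.Bijective
      (((A.subHom (A.leSubmodule b) _ _ : Hom (A.truncLE b) A).coneL L).map n) := by
  refine Hom.bijective_map_coneL_of_homogeneous _ Subtype.val_injective ?_ L n
  rintro n x ⟨y, hy⟩ hp hd
  replace hd : A.d x = y := hd
  suffices x ∈ A.leSubmodule b ∨ ∃ c, A.d c = x by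
    obtain h | ⟨c, rfl⟩ := this
    · exact ⟨0, ⟨x, h⟩, ((congrArg (· + x) (map_zero A.d)).trans (zero_add x)).symm⟩
    · exact ⟨c, 0, (add_zero _).symm⟩
  obtain hn | rfl | hn := lt_trichotomy n b
  · exact Or.inl (mem_leSubmodule_of_lt hp hn)
  · refine Or.inl ⟨fun m hm => p_eq_zero_of_p_eq hp hm.ne', ?_⟩
    rw [A.d_p, hd]
    exact hy.1 _ (by omega)
  · refine Or.inr (exists_d_eq_of_subsingleton (h n hn) hp ?_)
    rw [← hp, A.d_p, hd]
    exact hy.1 _ (by omega)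

/-- The cohomology of iterated cones of a complex concentrated in degree `b`. -/
lemma nonempty_H_coneL_truncLT_equiv (h : ∀ n < b, Subsingleton (A.H n)) (L : List R) (n : ℤ) :
    Nonempty (((A.truncLT (b + 1)).coneL L).H n ≃ₗ[R] ((single b (A.H b)).coneL L).H n) :=
  ⟨(LinearEquiv.ofBijective _ (bijective_map_coneL_truncLEHomLT L n)).symm.trans
    (LinearEquiv.ofBijective _
      ((shortExact_trunc.coneL L).bijective_of_acyclic_left ((isAcyclic_truncLT h).coneL L) n))⟩

lemma nonempty_H_coneL_single_equiv {N N' : Type u} [AddCommGroup N] [Module R N] [AddCommGroup N']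
    [Module R N'] (e : N ≃ₗ[R] N') (a : ℤ) (L : List R) (n : ℤ) :
    Nonempty (((single a N).coneL L).H n ≃ₗ[R] ((single a N').coneL L).H n) :=
  ⟨LinearEquiv.ofBijective _ ((singleHom a e.toLinearMap).bijective_map_coneL e.injective
    (fun b _ _ => ⟨0, e.symm b, (e.apply_symm_apply b).symm.trans (zero_add _).symm⟩) L n)⟩

end DiffModule

end Truncation

section Assembly

variable {K R 𝒜}

open DiffModule GDual

section

variable {A B C : ℤ → Type u} [∀ n, AddCommGroup (A n)] [∀ n, AddCommGroup (B n)]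
  [∀ n, AddCommGroup (C n)] [∀ n, Module R (A n)] [∀ n, Module R (B n)] [∀ n, Module R (C n)]

/-- The terms of a long exact sequence. -/
def seqObj (R : Type u) [CommRing R] (A B C : ℤ → Type u) [∀ n, AddCommGroup (A n)]
    [∀ n, AddCommGroup (B n)] [∀ n, AddCommGroup (C n)] [∀ n, Module R (A n)]
    [∀ n, Module R (B n)] [∀ n, Module R (C n)] : ℤ × Fin 3 → ModuleCat.{u} R
  | (j, 0) => ModuleCat.of R (A j)
  | (j, 1) => ModuleCat.of R (B j)
  | (j, 2) => ModuleCat.of R (C j)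

/-- The successor of an index. -/
def seqNext : ℤ × Fin 3 → ℤ × Fin 3
  | (j, 0) => (j, 1)
  | (j, 1) => (j, 2)
  | (j, 2) => (j + 1, 0)

/-- The position of an integer in a long exact sequence. -/
def seqIndex (k : ℤ) : ℤ × Fin 3 := (k / 3, ⟨(k % 3).toNat, by omega⟩)

lemma seqIndex_mul (j : ℤ) : seqIndex (3 * j) = (j, 0) :=
  Prod.ext (by simp [seqIndex]) (Fin.ext (by simp [seqIndex]))

lemma seqIndex_mul_add_one (j : ℤ) : seqIndex (3 * j + 1) = (j, 1) :=
  Prod.ext (by simp only [seqIndex]; omega) (Fin.ext (by simp only [seqIndex, Fin.val_one]; omega))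

lemma seqIndex_mul_add_two (j : ℤ) : seqIndex (3 * j + 2) = (j, 2) :=
  Prod.ext (by simp only [seqIndex]; omega) (Fin.ext (by simp only [seqIndex, Fin.val_two]; omega))

lemma seqIndex_succ (k : ℤ) : seqIndex (k + 1) = seqNext (seqIndex k) := by
  obtain ⟨j, rfl | rfl | rfl⟩ : ∃ j, k = 3 * j ∨ k = 3 * j + 1 ∨ k = 3 * j + 2 :=
    ⟨k / 3, by omega⟩
  · rw [seqIndex_mul, seqIndex_mul_add_one]
    rfl
  · rw [seqIndex_mul_add_one, add_assoc, one_add_one_eq_two, seqIndex_mul_add_two]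
    rfl
  · rw [seqIndex_mul_add_two, show 3 * j + 2 + 1 = 3 * (j + 1) by ring, seqIndex_mul]
    rfl

variable (α : ∀ n, A n →ₗ[R] B n) (β : ∀ n, B n →ₗ[R] C n) (δ : ∀ n, C n →ₗ[R] A (n + 1))

/-- The maps of a long exact sequence. -/
def seqHom : ∀ p : ℤ × Fin 3, seqObj R A B C p ⟶ seqObj R A B C (seqNext p)
  | (j, 0) => ModuleCat.ofHom (α j)
  | (j, 1) => ModuleCat.ofHom (β j)
  | (j, 2) => ModuleCat.ofHom (δ j)

lemma seqHom_exact (h₁ : ∀ n, Function.Exact (α n) (β n)) (h₂ : ∀ n, Function.Exact (β n) (δ n))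
    (h₃ : ∀ n, Function.Exact (δ n) (α (n + 1))) {p q r : ℤ × Fin 3} (hq : q = seqNext p)
    (hr : r = seqNext q) :
    Function.Exact (seqHom α β δ p ≫ eqToHom (congrArg (seqObj R A B C) hq.symm))
      (seqHom α β δ q ≫ eqToHom (congrArg (seqObj R A B C) hr.symm)) := by
  subst hq hr
  simp only [eqToHom_refl, Category.comp_id]
  match p with
  | (j, 0) => exact h₁ j
  | (j, 1) => exact h₂ j
  | (j, 2) => exact h₃ j

/-- Long exact sequences as sequences indexed by the integers. -/
lemma exists_long_exact_sequence (h₁ : ∀ n, Function.Exact (α n) (β n))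
    (h₂ : ∀ n, Function.Exact (β n) (δ n)) (h₃ : ∀ n, Function.Exact (δ n) (α (n + 1))) :
    ∃ (X : ℤ → ModuleCat.{u} R) (f : ∀ k : ℤ, X k ⟶ X (k + 1)),
      (∀ k : ℤ, Function.Exact (f k) (f (k + 1))) ∧
      ∀ j : ℤ, Nonempty ((X (3 * j) : Type u) ≃ₗ[R] A j) ∧
        Nonempty ((X (3 * j + 1) : Type u) ≃ₗ[R] B j) ∧
        Nonempty ((X (3 * j + 2) : Type u) ≃ₗ[R] C j) := by
  refine ⟨fun k => seqObj R A B C (seqIndex k), fun k => seqHom α β δ (seqIndex k) ≫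
    eqToHom (congrArg (seqObj R A B C) (seqIndex_succ k).symm), fun k =>
    seqHom_exact α β δ h₁ h₂ h₃ (seqIndex_succ k) (seqIndex_succ (k + 1)), fun j => ?_⟩
  have key {p q : ℤ × Fin 3} (h : p = q) :
      Nonempty (seqObj R A B C p ≃ₗ[R] seqObj R A B C q) := by
    subst h
    exact ⟨LinearEquiv.refl _ _⟩
  exact ⟨key (seqIndex_mul j), key (seqIndex_mul_add_one j), key (seqIndex_mul_add_two j)⟩

end

/-- The long exact sequence of a complex with cohomology in degrees `a` and `a + 1` only. -/
lemma DiffModule.exists_long_exact_sequence (D : DiffModule R) (a : ℤ)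
    (h : ∀ n, n < a → Subsingleton (D.H n)) (h' : ∀ n, a + 1 < n → Subsingleton (D.H n))
    (L : List R) (c : ℤ) :
    ∃ (X : ℤ → ModuleCat.{u} R) (f : ∀ k : ℤ, X k ⟶ X (k + 1)),
      (∀ k : ℤ, Function.Exact (f k) (f (k + 1))) ∧
      ∀ j : ℤ, Nonempty ((X (3 * j) : Type u) ≃ₗ[R] ((single a (D.H a)).coneL L).H (c + j)) ∧
        Nonempty ((X (3 * j + 1) : Type u) ≃ₗ[R] (D.coneL L).H (c + j)) ∧
        Nonempty ((X (3 * j + 2) : Type u) ≃ₗ[R]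
          ((single (a + 1) (D.H (a + 1))).coneL L).H (c + j)) := by
  have H := (shortExact_trunc (A := D) (b := a + 1)).coneL L
  choose δ hδ hδ' using fun j : ℤ => H.exists_connecting' (add_assoc c j 1)
  obtain ⟨X, f, hf, hX⟩ := _root_.exists_long_exact_sequence
    (A := fun j => ((D.truncLT (a + 1)).coneL L).H (c + j))
    (B := fun j => ((D.truncLE (a + 1)).coneL L).H (c + j))
    (C := fun j => ((single (a + 1) (D.H (a + 1))).coneL L).H (c + j))
    (fun j => ((D.truncLTHom (a + 1)).coneL L).map (c + j))
    (fun j => ((D.truncLEHom (a + 1)).coneL L).map (c + j)) δ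
    (fun j => H.exact_map (c + j)) hδ hδ'
  refine ⟨X, f, hf, fun j => ?_⟩
  obtain ⟨⟨e₁⟩, ⟨e₂⟩, e₃⟩ := hX j
  obtain ⟨e₁'⟩ := nonempty_H_coneL_truncLT_equiv (A := D) h L (c + j)
  exact ⟨⟨e₁.trans e₁'⟩,
    ⟨e₂.trans (LinearEquiv.ofBijective _ (bijective_map_coneL_truncLE h' L (c + j)))⟩, e₃⟩

lemma exists_list_generators {e : ℕ × ℕ} (h : (𝒜 e).FG) :
    ∃ L : List R, (∀ x ∈ L, x ∈ 𝒜 e) ∧ Submodule.span K {x | x ∈ L} = 𝒜 e ∧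
      Ideal.span {x | x ∈ L} = Ideal.span (𝒜 e : Set R) := by
  obtain ⟨S, hS⟩ := h
  have hL : {x | x ∈ S.toList} = (S : Set R) := by
    ext x
    simp
  refine ⟨S.toList, fun x hx => ?_, by rw [hL, hS], ?_⟩
  · rw [← hS]
    exact Submodule.subset_span (Finset.mem_toList.1 hx)
  · rw [hL, ← hS]
    exact (Submodule.span_span_of_tower K R (S : Set R)).symm

lemma IsStandardBigraded.isNoetherianRing [GradedAlgebra 𝒜] (h : IsStandardBigraded K R 𝒜) :
    IsNoetherianRing R := by
  obtain ⟨S, hS⟩ := h.fg10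
  obtain ⟨T, hT⟩ := h.fg01
  have : Algebra.FiniteType K R := by
    classical
    refine ⟨⟨S ∪ T, ?_⟩⟩
    rw [Finset.coe_union, Algebra.adjoin_union, ← h.adjoin_eq_top, Algebra.adjoin_union, ← hS, ← hT,
      Algebra.adjoin_span, Algebra.adjoin_span]
  exact Algebra.FiniteType.isNoetherianRing K R

lemma GrD.nonempty_dualH_equiv [GradedAlgebra 𝒜] {A : DiffModule R} (g : GrD 𝒜 A) {n i : ℤ}
    (h : -n = i) : Nonempty (g.dual.H n ≃ₗ[R] GDual (g.H i)) := by
  subst h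
  exact ⟨g.dualHEquiv n⟩

end Assembly

/-- **Proposition 2.12(a).**  Let `M` be a finitely generated bigraded `R`-module with
`dim M = s` and `depth M = s - 1` (encoded via local cohomology with respect to `R₊`).
Then there is a long exact sequence of bigraded `R`-modules
`⋯ → H^{m-j-2}_P(H^{s-1}_{R₊}(M)^∨) → H^{m-j}_P(H^s_{R₊}(M)^∨) → H^{s-m+j}_Q(M)^∨ →
H^{m-j-1}_P(H^{s-1}_{R₊}(M)^∨) → H^{m-j+1}_P(H^s_{R₊}(M)^∨) → ⋯`,
formalized as an exact sequence `X` indexed by `ℤ` with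
`X_{3j} ≅ H^{m+j}_P(H^s_{R₊}(M)^∨)`, `X_{3j+1} ≅ H^{s-m-j}_Q(M)^∨` and
`X_{3j+2} ≅ H^{m+j-1}_P(H^{s-1}_{R₊}(M)^∨)` for all `j : ℤ`. -/
theorem almost_CM_long_exact_sequence
    (K R : Type u) [Field K] [CommRing R] [Algebra K R]
    (𝒜 : ℕ × ℕ → Submodule K R) [GradedAlgebra 𝒜]
    (hstd : IsStandardBigraded K R 𝒜)
    (M : Type u) [AddCommGroup M] [Module R M] [Module.Finite R M]
    (bgM : Bigrading K R 𝒜 M)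
    (m : ℕ) (hm : MinimallyGeneratedBy K R 𝒜 m)
    (s : ℕ) (hs1 : 1 ≤ s)
    (hs : Nontrivial (LC R (idealRPlus K R 𝒜) (s : ℤ) M))
    (hs' : ∀ i : ℤ, (s : ℤ) < i → Subsingleton (LC R (idealRPlus K R 𝒜) i M))
    (ht : Nontrivial (LC R (idealRPlus K R 𝒜) ((s : ℤ) - 1) M))
    (ht' : ∀ i : ℤ, i < (s : ℤ) - 1 → Subsingleton (LC R (idealRPlus K R 𝒜) i M)) :
    ∃ (Ds : DualData K R 𝒜 ↥(LC R (idealRPlus K R 𝒜) (s : ℤ) M))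
      (Ds1 : DualData K R 𝒜 ↥(LC R (idealRPlus K R 𝒜) ((s : ℤ) - 1) M))
      (DQ : ∀ i : ℤ, DualData K R 𝒜 ↥(LC R (idealQ K R 𝒜) i M))
      (X : ℤ → ModuleCat.{u} R) (f : ∀ k : ℤ, X k ⟶ X (k + 1)),
      (∀ k : ℤ, Function.Exact (f k) (f (k + 1))) ∧
      (∀ j : ℤ,
        Nonempty ((X (3 * j) : Type u) ≃ₗ[R] ↥(LC R (idealP K R 𝒜) ((m : ℤ) + j) Ds.D)) ∧
        Nonempty ((X (3 * j + 1) : Type u) ≃ₗ[R] (DQ ((s : ℤ) - (m : ℤ) - j)).D) ∧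
        Nonempty ((X (3 * j + 2) : Type u) ≃ₗ[R]
          ↥(LC R (idealP K R 𝒜) ((m : ℤ) + j - 1) Ds1.D))) := by
  have := hstd.isNoetherianRing
  obtain ⟨LP, hLP, -, hLP'⟩ := exists_list_generators hstd.fg10
  obtain ⟨LQ, hLQ, -, hLQ'⟩ := exists_list_generators hstd.fg01
  let gQ := (GrD.single 0 bgM.toGr).coneL (0, 1) LQ hLQ
  let gC := gQ.coneL (1, 0) LP hLP
  have hQ (i : ℤ) : Nonempty (LC R (idealQ K R 𝒜) i M ≃ₗ[R]
      ((DiffModule.single 0 M).coneL LQ).H i) := by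
    rw [idealQ, ← hLQ']
    exact DiffModule.nonempty_LC_equiv LQ 0 i i (zero_add i) M
  have hspan : idealRPlus K R 𝒜 = Ideal.span {x | x ∈ LQ ++ LP} := by
    rw [idealRPlus, idealP, idealQ, ← hLP', ← hLQ', ← Ideal.span_union]
    congr 1
    ext x
    simp [or_comm]
  have hC (i : ℤ) : Nonempty (LC R (idealRPlus K R 𝒜) i M ≃ₗ[R]
      (((DiffModule.single 0 M).coneL LQ).coneL LP).H i) := by
    rw [hspan, ← DiffModule.coneL_append]
    exact DiffModule.nonempty_LC_equiv (LQ ++ LP) 0 i i (zero_add i) M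
  have hD (n : ℤ) (h : Subsingleton (LC R (idealRPlus K R 𝒜) (-n) M)) :
      Subsingleton (gC.dual.H n) := by
    obtain ⟨e⟩ := hC (-n)
    have := e.symm.toEquiv.subsingleton
    have := GDual.subsingleton (gC.H (-n))
    exact (gC.dualHEquiv n).toEquiv.subsingleton
  have hB : ∃ B, gQ.toGr.Bounded B := by
    obtain ⟨B, hB⟩ := bgM.toGr.exists_bounded
    exact ⟨B, GrD.bounded_coneL LQ hLQ (GrD.single 0 bgM.toGr) hB⟩
  obtain ⟨B, hB⟩ := hB
  have hGD (n i : ℤ) (h : -n = i) :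
      Nonempty ((gC.dual.coneL LP).H n ≃ₗ[R] GDual (gQ.H i)) := by
    obtain ⟨e₁⟩ := gQ.nonempty_H_dual_coneL_equiv LP (fun _ h => h) hLP n
    obtain ⟨e₂⟩ := DiffModule.nonempty_H_coneL_equiv_of_torsion (A := gQ.dual) LP
      (fun x hx φ => GDual.exists_pow_smul_eq_zero gQ.toGr hB (hLP x hx) φ) n
    obtain ⟨e₃⟩ := gQ.nonempty_dualH_equiv h
    exact ⟨e₁.symm.trans (e₂.trans e₃)⟩
  have hS (a n i k : ℤ) (h : a + i = n) (hk : -a = k) :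
      Nonempty (((DiffModule.single a (gC.dual.H a)).coneL LP).H n ≃ₗ[R]
        LC R (idealP K R 𝒜) i (GDual (gC.H k))) := by
    obtain ⟨e₁⟩ := gC.nonempty_dualH_equiv hk
    obtain ⟨e₂⟩ := DiffModule.nonempty_H_coneL_single_equiv e₁ a LP n
    obtain ⟨e₃⟩ := DiffModule.nonempty_LC_equiv LP a i n h (GDual (gC.H k))
    rw [idealP, ← hLP']
    exact ⟨e₂.trans e₃.symm⟩
  obtain ⟨X, f, hf, hX⟩ := gC.dual.exists_long_exact_sequence (-s)
    (fun n hn => hD n (hs' _ (by omega))) (fun n hn => hD n (ht' _ (by omega))) LP (m - s)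
  refine ⟨(gC.H s).dualData (hC s).some, (gC.H (s - 1)).dualData (hC (s - 1)).some,
    fun i => (gQ.H i).dualData (hQ i).some, X, f, hf, fun j => ?_⟩
  obtain ⟨⟨e₁⟩, ⟨e₂⟩, ⟨e₃⟩⟩ := hX j
  obtain ⟨e₁'⟩ := hS (-s) (m - s + j) (m + j) s (by ring) (by ring)
  obtain ⟨e₂'⟩ := hGD (m - s + j) (s - m - j) (by ring)
  obtain ⟨e₃'⟩ := hS (-s + 1) (m - s + j) (m + j - 1) (s - 1) (by ring) (by ring)
  exact ⟨⟨e₁.trans e₁'⟩, ⟨e₂.trans e₂'⟩, ⟨e₃.trans e₃'⟩⟩
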